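/- arXiv:1412.3936 — 6 statements merged into one kernel-verified Lean document; each statement's English description precedes it below -/
import Mathlib

section
/- Suppose θ ∈ ℝ is the only real root of an irreducible polynomial of the form x³ − p·x − q ∈ ℤ[x]. Then there exists a Peck sequence for the pair (θ, θ²); that is, there exist a strictly increasing sequence {sₙ} of positive integers, real constants M₁, M₂ > 0, and a strictly increasing function j : ℕ → ℕ such that, writing ψₙ = s_{j(n)} (so {ψₙ} is a subsequence of {sₙ} with ψₙ ≥ 2), for all n one has max{‖sₙ·θ‖, ‖sₙ·θ²‖} < M₁/√sₙ and ‖ψₙ·θ‖ < M₂/(√ψₙ · log ψₙ). -/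
open Polynomial

/-- Distance from a real number to the nearest integer. -/
noncomputable def distNearestInt (x : ℝ) : ℝ := |x - round x|

theorem Irrational.exists_rat_den_ge_abs_sub_lt {α : ℝ} (hα : Irrational α) (N : ℕ) :
    ∃ r : ℚ, N ≤ r.den ∧ |α - r| < 1 / (r.den : ℝ) ^ 2 := by
  by_contra! h
  refine Real.infinite_rat_abs_sub_lt_one_div_den_sq_of_irrational hα ?_
  obtain ⟨B, hB⟩ := exists_nat_gt ((|α| + 1) * N)
  have hfin : ((fun r : ℚ => (r.num, r.den)) ⁻¹'
      (Set.Icc (-(B : ℤ)) B ×ˢ Set.Iic N)).Finite := by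
    refine Set.Finite.preimage ?_ ((Set.finite_Icc _ _).prod (Set.finite_Iic _))
    intro a _ b _ hab
    simp only [Prod.mk.injEq] at hab
    exact Rat.ext hab.1 hab.2
  refine hfin.subset fun r hr => ?_
  have hr' : |α - r| < 1 / (r.den : ℝ) ^ 2 := hr
  have hden : r.den < N := by
    by_contra! hle
    exact absurd hr' (not_lt.mpr (h r hle))
  have hpos : (1 : ℝ) ≤ r.den := by exact_mod_cast r.pos
  have hle1 : 1 / (r.den : ℝ) ^ 2 ≤ 1 := by
    rw [div_le_one (by positivity)]; nlinarith
  have hrabs : |(r : ℝ)| ≤ |α| + 1 := by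
    have h1 := abs_sub_abs_le_abs_sub (r : ℝ) α
    rw [abs_sub_comm] at h1
    linarith
  have hnum : (r.num : ℝ) = r * r.den := by exact_mod_cast (Rat.mul_den_eq_num r).symm
  have hnumabs : |(r.num : ℝ)| ≤ B := by
    rw [hnum, abs_mul, Nat.abs_cast]
    have hN : (r.den : ℝ) ≤ N := by exact_mod_cast hden.le
    calc |(r : ℝ)| * r.den ≤ (|α| + 1) * N := by gcongr
      _ ≤ B := hB.le
  have hnumabs' : |r.num| ≤ B := by exact_mod_cast hnumabs
  exact ⟨abs_le.mp hnumabs', hden.le⟩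

/-- One-sided inhomogeneous approximation of a real `β` by multiples of an irrational `α`. -/
theorem Irrational.exists_nat_ge_mul_abs_add_sub_le {α : ℝ} (hα : Irrational α) (β : ℝ) (N : ℕ) :
    ∃ n : ℕ, N ≤ n ∧ ∃ m : ℤ, n * |n * α + β - m| ≤ 5 := by
  obtain ⟨r, hN, hr⟩ := hα.exists_rat_den_ge_abs_sub_lt N
  set b := r.den with hb
  have hbpos : 0 < b := r.pos
  set k := round (b * β) with hk
  have hcop : IsCoprime r.num (b : ℤ) := by
    rw [Int.isCoprime_iff_nat_coprime]; simpa using r.reduced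
  obtain ⟨x, y, hxy⟩ := hcop
  set t := (-k * x) % (b : ℤ) with ht
  have ht0 : 0 ≤ t := Int.emod_nonneg _ (by positivity)
  have ht1 : t < b := Int.emod_lt_of_pos _ (by positivity)
  have hdvd : (b : ℤ) ∣ (b + t) * r.num + k := by
    have h1 : -k * x = b * ((-k * x) / b) + t := (Int.mul_ediv_add_emod _ _).symm
    refine ⟨r.num - (-k * x) / b * r.num + k * y, ?_⟩
    linear_combination (-r.num) * h1 - k * hxy
  obtain ⟨m, hm⟩ := hdvd
  have hn : ((b + t.toNat : ℕ) : ℤ) = b + t := by push_cast; omega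
  have hnR : ((b + t.toNat : ℕ) : ℝ) = (b : ℝ) + t := by exact_mod_cast hn
  have hmR : ((b : ℝ) + t) * r.num + k = b * m := by exact_mod_cast hm
  refine ⟨b + t.toNat, by omega, m, ?_⟩
  rw [hnR]
  have hbR : (0 : ℝ) < b := by exact_mod_cast hbpos
  have ht0R : (0 : ℝ) ≤ t := by exact_mod_cast ht0
  have ht1R : (t : ℝ) ≤ b := by exact_mod_cast ht1.le
  have hnum : (r.num : ℝ) = r * b := by exact_mod_cast (Rat.mul_den_eq_num r).symm
  have hround := abs_sub_round ((b : ℝ) * β)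
  rw [← hk] at hround
  have hr2 : b * |b * (α - r)| ≤ 1 := by
    rw [abs_mul, Nat.abs_cast]
    rw [lt_div_iff₀ (by positivity)] at hr
    nlinarith
  have hkey : b * (((b : ℝ) + t) * α + β - m)
      = ((b : ℝ) + t) * (b * (α - r)) + (b * β - k) := by
    rw [hnum] at hmR
    linear_combination hmR
  have hbound : b * |((b : ℝ) + t) * α + β - m| ≤ 5 / 2 := by
    calc b * |((b : ℝ) + t) * α + β - m| = |b * (((b : ℝ) + t) * α + β - m)| := by
          rw [abs_mul, Nat.abs_cast]
      _ ≤ ((b : ℝ) + t) * |b * (α - r)| + |b * β - k| := by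
          rw [hkey]
          refine (abs_add_le _ _).trans ?_
          rw [abs_mul, abs_of_nonneg (by positivity : (0 : ℝ) ≤ b + t)]
      _ ≤ 2 * (b * |b * (α - r)|) + 1 / 2 := by
          have := abs_nonneg (b * (α - r))
          nlinarith
      _ ≤ 5 / 2 := by linarith
  have := abs_nonneg (((b : ℝ) + t) * α + β - m)
  nlinarith

theorem Complex.re_pow_mul (w c : ℂ) (n : ℕ) :
    (w ^ n * c).re = ‖w‖ ^ n * ‖c‖ * Real.cos (n * w.arg + c.arg) := by
  have h : w ^ n * c = ((‖w‖ ^ n * ‖c‖ : ℝ) : ℂ) *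
      Complex.exp (((n * w.arg + c.arg : ℝ) : ℂ) * Complex.I) := by
    conv_lhs => rw [← Complex.norm_mul_exp_arg_mul_I w, ← Complex.norm_mul_exp_arg_mul_I c]
    rw [mul_pow, ← Complex.exp_nat_mul]
    push_cast
    rw [show ((n : ℂ) * w.arg + c.arg) * Complex.I =
      n * (w.arg * Complex.I) + c.arg * Complex.I by ring, Complex.exp_add]
    ring
  rw [h, Complex.re_ofReal_mul, Complex.exp_ofReal_mul_I_re]

theorem Complex.exists_nat_ge_mul_abs_re_pow_mul_le {w : ℂ}
    (hw : Irrational (w.arg / Real.pi)) (c : ℂ) (N : ℕ) :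
    ∃ n : ℕ, N ≤ n ∧ n * |(w ^ n * c).re| ≤ 5 * Real.pi * ‖c‖ * ‖w‖ ^ n := by
  obtain ⟨n, hn, m, hm⟩ := hw.exists_nat_ge_mul_abs_add_sub_le (c.arg / Real.pi + 1 / 2) N
  refine ⟨n, hn, ?_⟩
  have hpi := Real.pi_pos
  set δ := n * (w.arg / Real.pi) + (c.arg / Real.pi + 1 / 2) - m with hδ
  have hcos : |Real.cos (n * w.arg + c.arg)| ≤ Real.pi * |δ| := by
    have h1 : n * w.arg + c.arg = (Real.pi * δ + m * Real.pi) - Real.pi / 2 := by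
      rw [hδ]; field_simp; ring
    rw [h1, Real.cos_sub_pi_div_two, Real.sin_add_int_mul_pi, abs_mul]
    have h2 : |((-1 : ℝ) ^ m)| = 1 := by simp
    rw [h2, one_mul]
    calc |Real.sin (Real.pi * δ)| ≤ |Real.pi * δ| := Real.abs_sin_le_abs
      _ = Real.pi * |δ| := by rw [abs_mul, abs_of_pos hpi]
  rw [Complex.re_pow_mul, abs_mul, abs_of_nonneg (by positivity : 0 ≤ ‖w‖ ^ n * ‖c‖)]
  calc n * (‖w‖ ^ n * ‖c‖ * |Real.cos (n * w.arg + c.arg)|)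
      ≤ n * (‖w‖ ^ n * ‖c‖ * (Real.pi * |δ|)) := by gcongr
    _ = (n * |δ|) * (Real.pi * ‖c‖ * ‖w‖ ^ n) := by ring
    _ ≤ 5 * (Real.pi * ‖c‖ * ‖w‖ ^ n) := by gcongr
    _ = _ := by ring

section CubicField

open NumberField ComplexConjugate

variable {K : Type*} [Field K] [NumberField K]

theorem NumberField.univ_algHom_eq_of_finrank_eq_three (h3 : Module.finrank ℚ K = 3)
    {φ₀ φ₁ φ₂ : K →ₐ[ℚ] ℂ} (h01 : φ₀ ≠ φ₁) (h02 : φ₀ ≠ φ₂) (h12 : φ₁ ≠ φ₂)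
    [DecidableEq (K →ₐ[ℚ] ℂ)] :
    (Finset.univ : Finset (K →ₐ[ℚ] ℂ)) = {φ₀, φ₁, φ₂} := by
  symm
  rw [← Finset.card_eq_iff_eq_univ, AlgHom.card, h3]
  exact Finset.card_eq_three.mpr ⟨φ₀, φ₁, φ₂, h01, h02, h12, rfl⟩

/-- In a cubic field, an element on which two embeddings agree has the same image under all
embeddings. -/
theorem NumberField.apply_eq_apply_of_finrank_eq_three (h3 : Module.finrank ℚ K = 3)
    {φ₀ φ₁ φ₂ : K →ₐ[ℚ] ℂ} (h12 : φ₁ ≠ φ₂) {x : K} (hx : φ₁ x = φ₂ x) : φ₀ x = φ₁ x := by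
  have := Subalgebra.isSimpleOrder_of_finrank_prime ℚ K (h3 ▸ Nat.prime_three)
  rcases eq_bot_or_eq_top (AlgHom.equalizer φ₁ φ₂) with h | h
  · have hmem : x ∈ AlgHom.equalizer φ₁ φ₂ := hx
    rw [h, Algebra.mem_bot] at hmem
    obtain ⟨r, rfl⟩ := hmem
    rw [φ₀.commutes, φ₁.commutes]
  · refine absurd (AlgHom.ext fun y => ?_) h12
    have hmem : y ∈ AlgHom.equalizer φ₁ φ₂ := h ▸ Algebra.mem_top
    exact hmem

theorem NumberField.ne_of_conj_eq {φ₀ φ₁ φ₂ : K →ₐ[ℚ] ℂ} (h₀ : ∀ x, conj (φ₀ x) = φ₀ x)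
    (h₂ : ∀ x, conj (φ₁ x) = φ₂ x) (h12 : φ₁ ≠ φ₂) : φ₀ ≠ φ₁ ∧ φ₀ ≠ φ₂ := by
  constructor
  · rintro rfl
    exact h12 (AlgHom.ext fun x => by rw [← h₂, h₀])
  · rintro rfl
    exact h12 (AlgHom.ext fun x => by rw [← h₀, ← h₂, Complex.conj_conj])

/-- The trace of an algebraic integer in a complex cubic field. -/
theorem NumberField.exists_int_cast_eq_add_two_mul_re (h3 : Module.finrank ℚ K = 3)
    {φ₀ φ₁ φ₂ : K →ₐ[ℚ] ℂ} (h₀ : ∀ x, conj (φ₀ x) = φ₀ x) (h₂ : ∀ x, conj (φ₁ x) = φ₂ x)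
    (h12 : φ₁ ≠ φ₂) {x : K} (hx : IsIntegral ℤ x) :
    ∃ k : ℤ, (k : ℂ) = φ₀ x + (2 * (φ₁ x).re : ℝ) := by
  classical
  obtain ⟨h01, h02⟩ := ne_of_conj_eq h₀ h₂ h12
  obtain ⟨k, hk⟩ := IsIntegrallyClosed.isIntegral_iff.mp (Algebra.isIntegral_trace (L := ℚ) hx)
  refine ⟨k, ?_⟩
  have h := trace_eq_sum_embeddings (K := ℚ) ℂ (x := x)
  rw [univ_algHom_eq_of_finrank_eq_three h3 h01 h02 h12, Finset.sum_insert (by simp [h01, h02]),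
    Finset.sum_pair h12, ← h₂, Complex.add_conj, ← hk] at h
  rw [← h]
  simp

/-- A cubic field with a real embedding `φ₀` and a non-real embedding `φ₁` contains a unit `u`
for which `φ₀ u = ε > 1` and the argument of `φ₁ u` is an irrational multiple of `π`. -/
theorem NumberField.exists_unit_of_finrank_eq_three (h3 : Module.finrank ℚ K = 3)
    {φ₀ φ₁ φ₂ : K →ₐ[ℚ] ℂ} (h₀ : ∀ x, conj (φ₀ x) = φ₀ x) (h₂ : ∀ x, conj (φ₁ x) = φ₂ x)
    (h12 : φ₁ ≠ φ₂) :
    ∃ (u : K) (ε : ℝ), IsIntegral ℤ u ∧ φ₀ u = ε ∧ 1 < ε ∧ ‖φ₁ u‖ ^ 2 * ε = 1 ∧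
      Irrational ((φ₁ u).arg / Real.pi) := by
  classical
  obtain ⟨h01, h02⟩ := ne_of_conj_eq h₀ h₂ h12
  obtain ⟨v, hv⟩ := Units.dirichletUnitTheorem.exists_unit K (InfinitePlace.mk (φ₀ : K →+* ℂ))
  set y : K := algebraMap (𝓞 K) K v with hy
  have hy0 : y ≠ 0 := by simp [hy]
  have hlt : ‖φ₁ y‖ < 1 := by
    have h := hv (InfinitePlace.mk (φ₁ : K →+* ℂ)) (by
      rw [Ne, InfinitePlace.mk_eq_iff]
      rintro (h | h)
      · exact h01 (AlgHom.ext fun x => (RingHom.congr_fun h x).symm)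
      · refine h02 (AlgHom.ext fun x => ?_)
        rw [← h₂]
        exact (RingHom.congr_fun h x).symm)
    rw [InfinitePlace.apply] at h
    have hpos : 0 < ‖φ₁ y‖ := by simpa using hy0
    exact (Real.log_neg_iff hpos).mp h
  obtain ⟨e, he⟩ := Complex.conj_eq_iff_real.mp (h₀ y)
  have hnorm : ‖φ₁ y‖ ^ 2 * |e| = 1 := by
    have h1 := Algebra.norm_eq_prod_embeddings ℚ ℂ y
    rw [univ_algHom_eq_of_finrank_eq_three h3 h01 h02 h12,
      Finset.prod_insert (by simp [h01, h02]), Finset.prod_pair h12, ← h₂, he] at h1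
    have h2 := congrArg norm h1
    rw [norm_mul, norm_mul, Complex.norm_conj, Complex.norm_real, Real.norm_eq_abs] at h2
    have h4 : ‖algebraMap ℚ ℂ (Algebra.norm ℚ y)‖ = 1 := by
      have h5 := Units.norm K v
      rw [eq_ratCast, Complex.norm_ratCast]
      exact_mod_cast h5
    rw [h4] at h2
    linarith
  have hpos : 0 < ‖φ₁ y‖ := by simpa using hy0
  have he1 : 1 < |e| := by
    by_contra! h
    nlinarith [abs_nonneg e]
  have hε1 : 1 < e ^ 2 := (one_lt_sq_iff_one_lt_abs e).mpr he1
  refine ⟨y ^ 2, e ^ 2, v.val.2.pow 2, by rw [map_pow, he]; push_cast; rfl, hε1, ?_, ?_⟩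
  · rw [map_pow, norm_pow, ← sq_abs e, ← mul_pow, hnorm, one_pow]
  rintro ⟨r, hr⟩
  set w := φ₁ (y ^ 2) with hw
  have hreal : conj (w ^ r.den) = w ^ r.den := by
    have harg : w.arg * r.den = r.num * Real.pi := by
      have hnum : (r.num : ℝ) = r * r.den := by exact_mod_cast (Rat.mul_den_eq_num r).symm
      rw [hnum, hr]; field_simp
    rw [Complex.conj_eq_iff_im]
    have h1 : w ^ r.den =
        ((‖w‖ ^ r.den : ℝ) : ℂ) * Complex.exp ((w.arg * r.den : ℝ) * Complex.I) := by
      conv_lhs => rw [← Complex.norm_mul_exp_arg_mul_I w]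
      rw [mul_pow, ← Complex.exp_nat_mul]
      push_cast
      ring_nf
    rw [h1, Complex.im_ofReal_mul, Complex.exp_ofReal_mul_I_im, harg, Real.sin_int_mul_pi, mul_zero]
  rw [hw, ← map_pow, h₂] at hreal
  have h := apply_eq_apply_of_finrank_eq_three (φ₀ := φ₀) h3 h12 hreal.symm
  have hn := congrArg norm h
  simp only [map_pow, norm_pow, he, Complex.norm_real, Real.norm_eq_abs] at hn
  have hd : r.den ≠ 0 := r.den_nz
  have hA : 1 < (|e| ^ 2) ^ r.den := one_lt_pow₀ (one_lt_pow₀ he1 two_ne_zero) hd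
  have hB : (‖φ₁ y‖ ^ 2) ^ r.den < 1 :=
    pow_lt_one₀ (by positivity) (pow_lt_one₀ hpos.le hlt two_ne_zero) hd
  linarith

end CubicField

section CubicPolynomial

open ComplexConjugate

variable {p q : ℤ} {θ : ℝ}

theorem exists_nonreal_root_of_unique_real_root
    (hq : q ≠ 0)
    (hroot : θ ^ 3 - (p : ℝ) * θ - (q : ℝ) = 0)
    (huniq : ∀ x : ℝ, x ^ 3 - (p : ℝ) * x - (q : ℝ) = 0 → x = θ) :
    ∃ z : ℂ, conj z ≠ z ∧ z ^ 3 - (p : ℂ) * z - (q : ℂ) = 0 := by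
  have hD : 0 < 3 * θ ^ 2 - 4 * p := by
    by_contra! hle
    have hs := Real.sq_sqrt (by linarith : (0 : ℝ) ≤ 4 * p - 3 * θ ^ 2)
    set d := √(4 * p - 3 * θ ^ 2)
    have h1 := huniq ((-θ + d) / 2) (by
      linear_combination hroot + (-θ + d - 2 * θ) / 8 * hs)
    have h2 := huniq ((-θ - d) / 2) (by
      linear_combination hroot + (-θ - d - 2 * θ) / 8 * hs)
    have hθ : θ = 0 := by linarith
    rw [hθ] at hroot
    apply hq
    have : (q : ℝ) = 0 := by linarith
    exact_mod_cast this
  have hs := Real.sq_sqrt hD.le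
  set d := √(3 * θ ^ 2 - 4 * p) with hd
  have hdpos : 0 < d := Real.sqrt_pos.mpr hD
  refine ⟨⟨-θ / 2, d / 2⟩, ?_, ?_⟩
  · rw [Ne, Complex.conj_eq_iff_im]
    simp only
    linarith
  · have hz : (⟨-θ / 2, d / 2⟩ : ℂ) = (-θ + d * Complex.I) / 2 := by
      apply Complex.ext <;> simp
    rw [hz]
    have hsC : (d : ℂ) ^ 2 = 3 * θ ^ 2 - 4 * p := by exact_mod_cast hs
    have hrC : (θ : ℂ) ^ 3 - p * θ - q = 0 := by exact_mod_cast hroot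
    linear_combination hrC + (-θ + d * Complex.I - 2 * θ) / 8 * (d ^ 2 * Complex.I_sq - hsC)

/-- The integers `s`, `a`, `b` are the traces of a power of a unit multiplied by
`1`, `θ`, `θ ^ 2`. -/
theorem exists_int_approximations
    (hirr : Irreducible (X ^ 3 - C (p : ℚ) * X - C (q : ℚ)))
    (hroot : θ ^ 3 - (p : ℝ) * θ - (q : ℝ) = 0)
    (huniq : ∀ x : ℝ, x ^ 3 - (p : ℝ) * x - (q : ℝ) = 0 → x = θ) :
    ∃ (ε : ℝ) (w z : ℂ), 1 < ε ∧ ‖w‖ ^ 2 * ε = 1 ∧ Irrational (w.arg / Real.pi) ∧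
      ∀ n : ℕ, ∃ s a b : ℤ, (s : ℝ) = ε ^ n + 2 * (w ^ n).re ∧
        s * θ - a = 2 * (w ^ n * (θ - z)).re ∧
        s * θ ^ 2 - b = 2 * (w ^ n * (θ ^ 2 - z ^ 2)).re := by
  set f : ℚ[X] := X ^ 3 - C (p : ℚ) * X - C (q : ℚ) with hf
  have hdeg : f.natDegree = 3 := by rw [hf]; compute_degree!
  have hq : q ≠ 0 := by
    intro hq
    have hroot0 : f.IsRoot 0 := by simp [hf, hq]
    have h1 := Polynomial.natDegree_eq_of_degree_eq_some
      (Polynomial.degree_eq_one_of_irreducible_of_root hirr hroot0)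
    rw [hdeg] at h1
    norm_num at h1
  obtain ⟨z, hz, hzroot⟩ := exists_nonreal_root_of_unique_real_root hq hroot huniq
  have : Fact (Irreducible f) := ⟨hirr⟩
  let K := AdjoinRoot f
  let pb := AdjoinRoot.powerBasis hirr.ne_zero
  have : FiniteDimensional ℚ K := pb.finite
  have : NumberField K := {}
  have h3 : Module.finrank ℚ K = 3 := by
    rw [pb.finrank, AdjoinRoot.powerBasis_dim, hdeg]
  let r : K := AdjoinRoot.root f
  have hext (g₁ g₂ : K →ₐ[ℚ] ℂ) (h : g₁ r = g₂ r) : g₁ = g₂ := AdjoinRoot.algHom_ext h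
  have hlift (x : ℂ) (hx : x ^ 3 - (p : ℂ) * x - (q : ℂ) = 0) : ∃ φ : K →ₐ[ℚ] ℂ, φ r = x := by
    have heval : f.aeval x = 0 := by simpa [hf] using hx
    exact ⟨AdjoinRoot.liftAlgHom f (Algebra.ofId ℚ ℂ) x heval, AdjoinRoot.liftAlgHom_root ..⟩
  obtain ⟨φ₀, hφ₀⟩ := hlift θ (by exact_mod_cast hroot)
  obtain ⟨φ₁, hφ₁⟩ := hlift z hzroot
  let cj : ℂ →ₐ[ℚ] ℂ := (Complex.conjAe.restrictScalars ℚ : ℂ ≃ₐ[ℚ] ℂ)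
  have hcj (x : ℂ) : cj x = conj x := rfl
  have h₀ (t : K) : conj (φ₀ t) = φ₀ t :=
    DFunLike.congr_fun (hext (cj.comp φ₀) φ₀ (by
      rw [AlgHom.comp_apply, hφ₀, hcj, Complex.conj_ofReal])) t
  have h₂ (t : K) : conj (φ₁ t) = cj.comp φ₁ t := rfl
  have h12 : φ₁ ≠ cj.comp φ₁ := fun h => hz (by
    have h' := DFunLike.congr_fun h r
    rw [AlgHom.comp_apply, hφ₁, hcj] at h'
    exact h'.symm)
  have hint : IsIntegral ℤ r := by
    refine ⟨X ^ 3 - C p * X - C q, by monicity!, ?_⟩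
    have hmap : (X ^ 3 - C p * X - C q : ℤ[X]).map (Int.castRingHom ℚ) = f := by simp [hf]
    have h := (congrArg (eval₂ (AdjoinRoot.of f) (AdjoinRoot.root f)) hmap).trans
      (AdjoinRoot.eval₂_root f)
    rw [eval₂_map] at h
    exact (congrArg (fun g : ℤ →+* K => eval₂ g r _) (Subsingleton.elim _ _)).trans h
  obtain ⟨u, ε, hu, huε, hε, hw, hirrat⟩ :=
    NumberField.exists_unit_of_finrank_eq_three h3 h₀ h₂ h12
  have htrace (n i : ℕ) : ∃ k : ℤ,
      (k : ℝ) = ε ^ n * θ ^ i + 2 * ((φ₁ u) ^ n * z ^ i).re := by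
    obtain ⟨k, hk⟩ := NumberField.exists_int_cast_eq_add_two_mul_re h3 h₀ h₂ h12
      ((hu.pow n).mul (hint.pow i))
    refine ⟨k, ?_⟩
    rw [map_mul, map_mul, map_pow, map_pow, map_pow, map_pow, hφ₀, hφ₁, huε] at hk
    exact_mod_cast hk
  refine ⟨ε, φ₁ u, z, hε, hw, hirrat, fun n => ?_⟩
  obtain ⟨s, hs⟩ := htrace n 0
  obtain ⟨a, ha⟩ := htrace n 1
  obtain ⟨b, hb⟩ := htrace n 2
  simp only [pow_zero, mul_one, pow_one] at hs ha
  refine ⟨s, a, b, hs, ?_, ?_⟩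
  · rw [hs, ha, mul_sub, Complex.sub_re, mul_comm _ (θ : ℂ), Complex.re_ofReal_mul]
    ring
  · rw [hs, hb, mul_sub, Complex.sub_re, mul_comm _ ((θ : ℂ) ^ 2), ← Complex.ofReal_pow,
      Complex.re_ofReal_mul]
    ring

end CubicPolynomial

theorem distNearestInt_le (x : ℝ) (k : ℤ) : distNearestInt x ≤ |x - k| := round_le x k

theorem pow_le_two_div_sqrt {r ε s : ℝ} {n : ℕ} (hrε : r ^ 2 * ε = 1) (hs : 0 < s)
    (hsε : s ≤ 3 * ε ^ n) : r ^ n ≤ 2 / √s := by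
  rw [le_div_iff₀ (Real.sqrt_pos.mpr hs)]
  refine abs_le_of_sq_le_sq' ?_ (by norm_num) |>.2
  have h : (r ^ n) ^ 2 * ε ^ n = 1 := by
    rw [← pow_mul, mul_comm n, pow_mul, ← mul_pow, hrε, one_pow]
  rw [mul_pow, Real.sq_sqrt hs.le]
  nlinarith [sq_nonneg (r ^ n)]

theorem exists_large_good_approximation {p q : ℤ} {θ : ℝ}
    (hirr : Irreducible (X ^ 3 - C (p : ℚ) * X - C (q : ℚ)))
    (hroot : θ ^ 3 - (p : ℝ) * θ - (q : ℝ) = 0)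
    (huniq : ∀ x : ℝ, x ^ 3 - (p : ℝ) * x - (q : ℝ) = 0 → x = θ) :
    ∃ M₁ M₂ : ℝ, 0 < M₁ ∧ 0 < M₂ ∧ ∀ N : ℕ, ∃ s : ℕ, N < s ∧ 2 ≤ s ∧
      max (distNearestInt (s * θ)) (distNearestInt (s * θ ^ 2)) < M₁ / √s ∧
      distNearestInt (s * θ) < M₂ / (√s * Real.log s) := by
  obtain ⟨ε, w, z, hε, hw, hirrat, hint⟩ := exists_int_approximations hirr hroot huniq
  set c₁ : ℂ := θ - z
  set c₂ : ℂ := θ ^ 2 - z ^ 2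
  have hεpos : 0 < ε := by linarith
  have hlogε : 0 < Real.log ε := Real.log_pos hε
  have hlog3 : 0 < Real.log 3 := Real.log_pos (by norm_num)
  have hpi := Real.pi_pos
  set L := Real.log 3 + Real.log ε with hL
  have hLpos : 0 < L := by positivity
  refine ⟨4 * (‖c₁‖ + ‖c₂‖) + 1, 20 * Real.pi * ‖c₁‖ * L + 1, by positivity, by positivity,
    fun N => ?_⟩
  obtain ⟨n₀, hn₀⟩ := pow_unbounded_of_one_lt ((N : ℝ) + 4) hε
  obtain ⟨n, hn, hnre⟩ :=
    Complex.exists_nat_ge_mul_abs_re_pow_mul_le hirrat c₁ (max n₀ 1)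
  have hn1 : 1 ≤ n := le_of_max_le_right hn
  obtain ⟨s, a, b, hs, ha, hb⟩ := hint n
  have hw1 : ‖w‖ ≤ 1 := by
    by_contra! h
    nlinarith
  have hwn : |(w ^ n).re| ≤ 1 := by
    refine (Complex.abs_re_le_norm _).trans ?_
    rw [norm_pow]
    exact pow_le_one₀ (norm_nonneg w) hw1
  rw [abs_le] at hwn
  have hεn : (N : ℝ) + 4 < ε ^ n :=
    hn₀.trans_le (pow_le_pow_right₀ hε.le (le_of_max_le_left hn))
  have hsN : (N : ℝ) + 2 < s := by linarith
  have hsN' : (N : ℤ) + 2 < s := by exact_mod_cast hsN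
  obtain ⟨t, rfl⟩ := Int.eq_ofNat_of_zero_le (by omega : 0 ≤ s)
  rw [Int.cast_natCast] at *
  have hNnn : (0 : ℝ) ≤ N := Nat.cast_nonneg N
  have htpos : (0 : ℝ) < t := by linarith
  have ht3 : (t : ℝ) ≤ 3 * ε ^ n := by linarith
  have hsqrt : 0 < √(t : ℝ) := Real.sqrt_pos.mpr htpos
  have hlogt : 0 < Real.log t := Real.log_pos (by linarith)
  have hnR : (1 : ℝ) ≤ n := by exact_mod_cast hn1
  have hlogtn : Real.log t ≤ n * L := by
    calc Real.log t ≤ Real.log (3 * ε ^ n) := Real.log_le_log htpos ht3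
      _ = Real.log 3 + n * Real.log ε := by
          rw [Real.log_mul (by norm_num) (by positivity), Real.log_pow]
      _ ≤ n * L := by rw [hL]; nlinarith
  have hpow : ‖w‖ ^ n ≤ 2 / √(t : ℝ) := pow_le_two_div_sqrt hw htpos ht3
  have hre (c : ℂ) : |2 * (w ^ n * c).re| ≤ 4 * ‖c‖ / √(t : ℝ) := by
    rw [abs_mul, abs_two]
    calc 2 * |(w ^ n * c).re| ≤ 2 * (‖w‖ ^ n * ‖c‖) := by
          gcongr
          exact (Complex.abs_re_le_norm _).trans_eq (by rw [norm_mul, norm_pow])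
      _ ≤ 2 * (2 / √(t : ℝ) * ‖c‖) := by gcongr
      _ = 4 * ‖c‖ / √(t : ℝ) := by ring
  have hθ : distNearestInt (t * θ) ≤ |2 * (w ^ n * c₁).re| :=
    ha ▸ distNearestInt_le _ a
  have hθ2 : distNearestInt (t * θ ^ 2) ≤ |2 * (w ^ n * c₂).re| :=
    hb ▸ distNearestInt_le _ b
  refine ⟨t, by omega, by omega, max_lt ?_ ?_, ?_⟩
  · refine (hθ.trans (hre c₁)).trans_lt ?_
    gcongr
    linarith [norm_nonneg c₂]
  · refine (hθ2.trans (hre c₂)).trans_lt ?_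
    gcongr
    linarith [norm_nonneg c₁]
  · refine hθ.trans_lt ?_
    rw [lt_div_iff₀ (by positivity), abs_mul, abs_two]
    calc 2 * |(w ^ n * c₁).re| * (√(t : ℝ) * Real.log t)
        ≤ 2 * |(w ^ n * c₁).re| * (√(t : ℝ) * (n * L)) := by gcongr
      _ = 2 * (n * |(w ^ n * c₁).re|) * (√(t : ℝ) * L) := by ring
      _ ≤ 2 * (5 * Real.pi * ‖c₁‖ * (2 / √(t : ℝ))) * (√(t : ℝ) * L) := by
          have h := hnre.trans (mul_le_mul_of_nonneg_left hpow (by positivity))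
          exact mul_le_mul_of_nonneg_right (mul_le_mul_of_nonneg_left h zero_le_two) (by positivity)
      _ = 20 * Real.pi * ‖c₁‖ * L := by field_simp; ring
      _ < _ := by linarith

/-- **Theorem 1.** If `θ` is the only real root of an irreducible polynomial of the form
`x³ - p x - q ∈ ℤ[x]`, then there is a Peck sequence for the pair `(θ, θ²)`. -/
theorem peck_sequence_for_theta_thetasq
    (p q : ℤ) (θ : ℝ)
    (hirr : Irreducible (X ^ 3 - C (p : ℚ) * X - C (q : ℚ)))
    (hroot : θ ^ 3 - (p : ℝ) * θ - (q : ℝ) = 0)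
    (huniq : ∀ x : ℝ, x ^ 3 - (p : ℝ) * x - (q : ℝ) = 0 → x = θ) :
    ∃ (s : ℕ → ℕ) (M₁ M₂ : ℝ) (j : ℕ → ℕ),
      StrictMono s ∧ (∀ n, 0 < s n) ∧ 0 < M₁ ∧ 0 < M₂ ∧ StrictMono j ∧
      (∀ n, 2 ≤ s (j n)) ∧
      (∀ n, max (distNearestInt ((s n : ℝ) * θ)) (distNearestInt ((s n : ℝ) * θ ^ 2))
          < M₁ / Real.sqrt (s n)) ∧
      (∀ n, distNearestInt ((s (j n) : ℝ) * θ)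
          < M₂ / (Real.sqrt (s (j n)) * Real.log (s (j n)))) := by
  obtain ⟨M₁, M₂, hM₁, hM₂, h⟩ := exists_large_good_approximation hirr hroot huniq
  choose g hgN hg2 hg using h
  have hmono : StrictMono fun n => g^[n + 1] 0 :=
    strictMono_nat_of_lt_succ fun n => by
      rw [Function.iterate_succ_apply' g (n + 1)]
      exact hgN _
  refine ⟨fun n => g^[n + 1] 0, M₁, M₂, id, hmono, fun n => ?_, hM₁, hM₂, strictMono_id,
    fun n => ?_, fun n => ?_, fun n => ?_⟩ <;>
    simp only [id, Function.iterate_succ_apply']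
  · exact two_pos.trans_le (hg2 _)
  · exact hg2 _
  · exact (hg _).1
  · exact (hg _).2
end

section
/- Suppose α ∈ ℝ is the only real root of an irreducible cubic polynomial in ℚ[x]. Then there exists a Peck sequence for the pair (α, α²); that is, there exist a strictly increasing sequence {sₙ} of positive integers, real constants M₁, M₂ > 0, and a strictly increasing function j : ℕ → ℕ such that, writing ψₙ = s_{j(n)} (so ψₙ ≥ 2), for all n one has max{‖sₙ·α‖, ‖sₙ·α²‖} < M₁/√sₙ and ‖ψₙ·α‖ < M₂/(√ψₙ · log ψₙ). -/
open Polynomial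

theorem frequently_abs_mul_sub_le_one_div (ξ : ℝ) :
    ∃ᶠ m : ℕ in Filter.atTop, ∃ k : ℤ, |(m : ℝ) * ξ - k| ≤ 1 / m := by
  rw [Filter.frequently_atTop]
  intro T
  by_cases h : ∃ k : ℕ, 0 < k ∧ (k : ℝ) * ξ = round ((k : ℝ) * ξ)
  · obtain ⟨k, hk, hkξ⟩ := h
    refine ⟨T * k, Nat.le_mul_of_pos_right T hk, T * round ((k : ℝ) * ξ), ?_⟩
    have : ((T * k : ℕ) : ℝ) * ξ - ((T * round ((k : ℝ) * ξ) : ℤ) : ℝ) = 0 := by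
      push_cast
      rw [← hkξ]
      ring
    rw [this, abs_zero]
    positivity
  · push Not at h
    obtain ⟨ρ, hρ, hmin⟩ : ∃ ρ : ℝ, 0 < ρ ∧
        ∀ k ∈ Finset.Icc 1 (T + 1), ρ ≤ |(k : ℝ) * ξ - round ((k : ℝ) * ξ)| := by
      obtain ⟨k₀, hk₀, hle⟩ := Finset.exists_min_image (Finset.Icc 1 (T + 1))
        (fun k : ℕ => |(k : ℝ) * ξ - round ((k : ℝ) * ξ)|) ⟨1, by simp⟩
      exact ⟨_, abs_pos.2 (sub_ne_zero.2 (h k₀ (Finset.mem_Icc.1 hk₀).1)), hle⟩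
    obtain ⟨n, hn⟩ := exists_nat_one_div_lt hρ
    obtain ⟨k, hk, hkn, hkle⟩ := Real.exists_nat_abs_mul_sub_round_le ξ (Nat.succ_pos n)
    have hk' : (0 : ℝ) < k := by exact_mod_cast hk
    have hkn' : (k : ℝ) ≤ n + 1 := by exact_mod_cast hkn
    push_cast at hkle
    refine ⟨k, ?_, round ((k : ℝ) * ξ), hkle.trans ?_⟩
    · by_contra! hlt
      have h1 := hmin k (Finset.mem_Icc.2 ⟨hk, by omega⟩)
      have h2 : (1 : ℝ) / (n + 1 + 1) ≤ 1 / (n + 1) := by gcongr; linarith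
      linarith
    · gcongr
      linarith

theorem Complex.frequently_abs_im_pow_le (z : ℂ) :
    ∃ᶠ m : ℕ in Filter.atTop, |(z ^ m).im| ≤ Real.pi * ‖z‖ ^ m / m := by
  refine (frequently_abs_mul_sub_le_one_div (z.arg / Real.pi)).mono ?_
  rintro m ⟨k, hk⟩
  have him : (z ^ m).im = ‖z‖ ^ m * Real.sin (m * z.arg) := by
    conv_lhs => rw [← Complex.norm_mul_exp_arg_mul_I z]
    rw [mul_pow, ← Complex.exp_nat_mul, ← Complex.ofReal_pow, Complex.im_ofReal_mul, ← mul_assoc,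
      ← Complex.exp_ofReal_mul_I_im]
    push_cast
    rfl
  have hsin : |Real.sin (m * z.arg)| ≤ Real.pi * (1 / m) := by
    have h1 : |Real.sin (m * z.arg)| = |Real.sin (m * z.arg - k * Real.pi)| := by
      rw [Real.sin_sub_int_mul_pi, abs_mul, abs_zpow, abs_neg, abs_one, one_zpow, one_mul]
    have h2 : m * z.arg - k * Real.pi = Real.pi * (m * (z.arg / Real.pi) - k) := by
      field_simp
    rw [h1, h2]
    refine (Real.abs_sin_le_abs).trans ?_
    rw [abs_mul, abs_of_pos Real.pi_pos]
    gcongr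
  rw [him, abs_mul, abs_of_nonneg (by positivity)]
  calc ‖z‖ ^ m * |Real.sin (m * z.arg)| ≤ ‖z‖ ^ m * (Real.pi * (1 / m)) := by gcongr
    _ = _ := by ring

theorem PowerBasis.exists_natCast_mul_eq_of_dim_eq_three {K : Type*} [Field K] [CharZero K]
    [Algebra ℚ K] (pb : PowerBasis ℚ K) (hdim : pb.dim = 3) (y : K) :
    ∃ d : ℕ, 0 < d ∧ ∃ a b c : ℤ, (d : K) * y = a + b * pb.gen + c * pb.gen ^ 2 := by
  obtain ⟨q₀, q₁, q₂, hy⟩ : ∃ q₀ q₁ q₂ : ℚ, y = q₀ + q₁ * pb.gen + q₂ * pb.gen ^ 2 := by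
    have h := (pb.basis.reindex (finCongr hdim)).sum_repr y
    rw [Fin.sum_univ_three] at h
    exact ⟨_, _, _, by simpa [Algebra.smul_def] using h.symm⟩
  refine ⟨q₀.den * q₁.den * q₂.den, by positivity, q₀.num * q₁.den * q₂.den,
    q₁.num * q₀.den * q₂.den, q₂.num * q₀.den * q₁.den, ?_⟩
  have h (q : ℚ) : (q.num : K) = q * q.den := by exact_mod_cast (Rat.mul_den_eq_num q).symm
  push_cast
  rw [hy, h, h, h]
  ring

open NumberField in
theorem NumberField.exists_natCast_mul_eq_of_dim_eq_three {K : Type*} [Field K] [NumberField K]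
    (pb : PowerBasis ℚ K) (hdim : pb.dim = 3) :
    ∃ D : ℕ, 0 < D ∧ ∀ x : 𝓞 K, ∃ a b c : ℤ,
      (D : K) * x = a + b * pb.gen + c * pb.gen ^ 2 := by
  obtain ⟨S, hS⟩ := (Module.finite_def (R := ℤ) (M := 𝓞 K)).1 inferInstance
  choose d hd a b c h using fun x : 𝓞 K => pb.exists_natCast_mul_eq_of_dim_eq_three hdim (x : K)
  refine ⟨∏ x ∈ S, d x, Finset.prod_pos fun x _ => hd x, fun x => ?_⟩
  have hx : x ∈ Submodule.span ℤ (S : Set (𝓞 K)) := hS ▸ Submodule.mem_top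
  induction hx using Submodule.span_induction with
  | mem x hx =>
    obtain ⟨e, he⟩ := Finset.dvd_prod_of_mem d hx
    refine ⟨e * a x, e * b x, e * c x, ?_⟩
    rw [he]
    push_cast
    linear_combination (e : K) * h x
  | zero => exact ⟨0, 0, 0, by simp⟩
  | add x y _ _ hx hy =>
    obtain ⟨a₁, b₁, c₁, h₁⟩ := hx
    obtain ⟨a₂, b₂, c₂, h₂⟩ := hy
    refine ⟨a₁ + a₂, b₁ + b₂, c₁ + c₂, ?_⟩
    push_cast [map_add]
    push_cast at h₁ h₂
    linear_combination h₁ + h₂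
  | smul k x _ hx =>
    obtain ⟨a₁, b₁, c₁, h₁⟩ := hx
    refine ⟨k * a₁, k * b₁, k * c₁, ?_⟩
    rw [zsmul_eq_mul]
    push_cast [map_mul] at h₁ ⊢
    rw [map_intCast]
    linear_combination (k : K) * h₁

theorem AlgHom.univ_eq_of_finrank_eq_three {K : Type*} [Field K] [NumberField K]
    (hK : Module.finrank ℚ K = 3) {σ₁ σ₂ σ₃ : K →ₐ[ℚ] ℂ} (h₁₂ : σ₁ ≠ σ₂) (h₁₃ : σ₁ ≠ σ₃)
    (h₂₃ : σ₂ ≠ σ₃) [DecidableEq (K →ₐ[ℚ] ℂ)] :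
    (Finset.univ : Finset (K →ₐ[ℚ] ℂ)) = {σ₁, σ₂, σ₃} := by
  symm
  rw [← Finset.card_eq_iff_eq_univ, Finset.card_eq_three.2 ⟨σ₁, σ₂, σ₃, h₁₂, h₁₃, h₂₃, rfl⟩,
    AlgHom.card, hK]

open NumberField in
theorem NumberField.exists_unit_of_complex_cubic {K : Type*} [Field K] [NumberField K]
    (hK : Module.finrank ℚ K = 3) (σ : K →ₐ[ℚ] ℝ) (τ : K →ₐ[ℚ] ℂ) {θ : K}
    (hτ : (τ θ).im ≠ 0) :
    ∃ u : (𝓞 K)ˣ, 1 < |σ u| ∧ ‖τ u‖ ^ 2 * |σ u| = 1 := by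
  classical
  let σ' : K →ₐ[ℚ] ℂ := (IsScalarTower.toAlgHom ℚ ℝ ℂ).comp σ
  let τ' : K →ₐ[ℚ] ℂ := (Complex.conjAe.toAlgHom.restrictScalars ℚ).comp τ
  have hσ' (x : K) : σ' x = (σ x : ℂ) := rfl
  have hτ' (x : K) : τ' x = starRingEnd ℂ (τ x) := rfl
  have h₁₂ : σ' ≠ τ := fun h => hτ (by rw [← h, hσ', Complex.ofReal_im])
  have h₁₃ : σ' ≠ τ' := fun h => hτ (by
    have := congrArg Complex.im (DFunLike.congr_fun h θ)
    rw [hσ', hτ', Complex.ofReal_im, Complex.conj_im] at this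
    linarith)
  have h₂₃ : τ ≠ τ' := fun h => hτ (by
    have := congrArg Complex.im (DFunLike.congr_fun h θ)
    rw [hτ', Complex.conj_im] at this
    linarith)
  obtain ⟨u, hu⟩ := Units.dirichletUnitTheorem.exists_unit K (InfinitePlace.mk σ'.toRingHom)
  have hne : InfinitePlace.mk τ.toRingHom ≠ InfinitePlace.mk σ'.toRingHom := by
    rw [Ne, InfinitePlace.mk_eq_iff]
    rintro (h | h)
    · exact h₁₂ (AlgHom.ext fun x => (DFunLike.congr_fun h x).symm)
    · refine h₁₃ (AlgHom.ext fun x => (DFunLike.congr_fun h x).symm)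
  have hlog : Real.log ‖τ (u : K)‖ < 0 := hu _ hne
  have hprod : ‖τ (u : K)‖ ^ 2 * |σ (u : K)| = 1 := by
    have h := Algebra.norm_eq_prod_embeddings ℚ ℂ (u : K)
    rw [AlgHom.univ_eq_of_finrank_eq_three hK h₁₂ h₁₃ h₂₃,
      Finset.prod_insert (by simp [h₁₂, h₁₃]), Finset.prod_pair h₂₃] at h
    have h' := congrArg norm h
    rw [norm_mul, norm_mul, hσ', hτ', Complex.norm_conj, Complex.norm_real, Real.norm_eq_abs,
      eq_ratCast, Complex.norm_ratCast, ← Rat.cast_abs, Units.norm, Rat.cast_one] at h'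
    linarith
  have hpos : 0 < ‖τ (u : K)‖ := by
    rw [norm_pos_iff]
    intro h0
    rw [h0] at hprod
    simp at hprod
  have hlt : ‖τ (u : K)‖ < 1 := (Real.log_neg_iff hpos).1 hlog
  refine ⟨u, ?_, hprod⟩
  have : ‖τ (u : K)‖ ^ 2 < 1 := pow_lt_one₀ hpos.le hlt two_ne_zero
  by_contra! hle
  nlinarith [abs_nonneg (σ (u : K)), sq_nonneg ‖τ (u : K)‖]

theorem exists_powers_of_complex_cubic (f : ℚ[X]) (hirr : Irreducible f) (hdeg : f.natDegree = 3)
    (α : ℝ) (hroot : aeval α f = 0) (huniq : ∀ x : ℝ, aeval x f = 0 → x = α) :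
    ∃ (β z : ℂ) (E : ℝ) (D : ℕ), β.im ≠ 0 ∧ aeval β f = 0 ∧ 1 < E ∧ ‖z‖ ^ 2 * E = 1 ∧ 0 < D ∧
      ∀ n : ℕ, ∃ a b c : ℤ, (D : ℝ) * E ^ n = a + b * α + c * α ^ 2 ∧
        (D : ℂ) * z ^ n = a + b * β + c * β ^ 2 := by
  have := Fact.mk hirr
  let pb := AdjoinRoot.powerBasis hirr.ne_zero
  have hdim : pb.dim = 3 := (AdjoinRoot.powerBasis_dim hirr.ne_zero).trans hdeg
  have hgen : pb.gen = AdjoinRoot.root f := AdjoinRoot.powerBasis_gen hirr.ne_zero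
  have : FiniteDimensional ℚ (AdjoinRoot f) := pb.finite
  have : NumberField (AdjoinRoot f) := ⟨⟩
  have hfin : Module.finrank ℚ (AdjoinRoot f) = 3 := pb.finrank.trans hdim
  have haeval : aeval pb.gen f = 0 := by
    rw [hgen, aeval_def, ← AdjoinRoot.eval₂_root f]
    congr 1
  let σ : AdjoinRoot f →ₐ[ℚ] ℝ := AdjoinRoot.liftAlgHom f (Algebra.ofId ℚ ℝ) α hroot
  have hσ : σ pb.gen = α := by rw [hgen]; exact AdjoinRoot.liftAlgHom_root ..
  obtain ⟨τ, hτ⟩ : ∃ τ : AdjoinRoot f →ₐ[ℚ] ℂ, (τ pb.gen).im ≠ 0 := by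
    by_contra! h
    have hα (τ : AdjoinRoot f →ₐ[ℚ] ℂ) : τ pb.gen = α := by
      have hre : ((τ pb.gen).re : ℂ) = τ pb.gen := Complex.ext rfl (h τ).symm
      have h0 : aeval (τ pb.gen) f = 0 := by rw [aeval_algHom_apply, haeval, map_zero]
      rw [← hre, ← Complex.coe_algebraMap, aeval_algebraMap_apply, Complex.coe_algebraMap,
        Complex.ofReal_eq_zero] at h0
      rw [← hre, huniq _ h0]
    have hsub : Subsingleton (AdjoinRoot f →ₐ[ℚ] ℂ) :=
      ⟨fun τ₁ τ₂ => pb.algHom_ext ((hα τ₁).trans (hα τ₂).symm)⟩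
    have h1 := Fintype.card_le_one_iff_subsingleton.2 hsub
    rw [AlgHom.card, hfin] at h1
    omega
  obtain ⟨u, hu, hprod⟩ := NumberField.exists_unit_of_complex_cubic hfin σ τ hτ
  obtain ⟨D, hD, hrep⟩ := NumberField.exists_natCast_mul_eq_of_dim_eq_three pb hdim
  refine ⟨τ pb.gen, τ u ^ 2, σ u ^ 2, D, hτ, ?_, ?_, ?_, hD, fun n => ?_⟩
  · rw [aeval_algHom_apply, haeval, map_zero]
  · rw [← sq_abs]
    exact one_lt_pow₀ hu two_ne_zero
  · rw [norm_pow, ← sq_abs (σ _), ← mul_pow, hprod, one_pow]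
  · obtain ⟨a, b, c, h⟩ := hrep ((u ^ 2) ^ n : (NumberField.RingOfIntegers (AdjoinRoot f))ˣ)
    push_cast [map_pow] at h
    refine ⟨a, b, c, ?_, ?_⟩
    · simpa [hσ] using congrArg σ h
    · simpa using congrArg τ h

theorem quadratic_relation_of_cubic_roots (f : ℚ[X]) (hdeg : f.natDegree = 3) {α : ℝ} {β : ℂ}
    (hα : aeval α f = 0) (hβ : aeval β f = 0) (him : β.im ≠ 0) :
    ∃ A B : ℚ, (A : ℝ) = -(2 * β.re + α) ∧ (B : ℝ) = β.re ^ 2 + β.im ^ 2 + 2 * β.re * α := by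
  have h3 : f.coeff 3 ≠ 0 := by
    rw [← hdeg, coeff_natDegree, leadingCoeff_ne_zero]
    rintro rfl
    simp at hdeg
  have h3' : (f.coeff 3 : ℝ) ≠ 0 := by exact_mod_cast h3
  rw [aeval_eq_sum_range, hdeg] at hα hβ
  simp only [Finset.sum_range_succ, Finset.sum_range_zero, Algebra.smul_def, eq_ratCast] at hα hβ
  obtain ⟨x, y⟩ := β
  have hre := congrArg Complex.re hβ
  have him' := congrArg Complex.im hβ
  simp [pow_succ] at hre him' hα him
  have hlin : (f.coeff 1 : ℝ) + 2 * f.coeff 2 * x + f.coeff 3 * (3 * x ^ 2 - y ^ 2) = 0 :=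
    mul_left_cancel₀ him (by linear_combination him')
  have hF : (α - x) ^ 2 + y ^ 2 ≠ 0 := by positivity
  have hA : (f.coeff 2 : ℝ) + f.coeff 3 * (2 * x + α) = 0 :=
    mul_left_cancel₀ hF (by linear_combination hα - hre - (α - x) * hlin)
  refine ⟨f.coeff 2 / f.coeff 3, f.coeff 1 / f.coeff 3, ?_, ?_⟩
  · push_cast
    rw [div_eq_iff h3']
    linear_combination hA
  · push_cast
    rw [div_eq_iff h3']
    linear_combination hlin - 2 * x * hA

/-- If `w = a + b β + c β²` and `α`, `β`, `conj β` are the roots of a cubic with rational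
coefficients `A`, `B` (of degree two and one), then the distances of `c α` and `c α²` to the
rationals predicted by `a` and `b` are controlled by `w`. -/
theorem abs_coord_error_le {α A B a b c : ℝ} {β w : ℂ} (him : β.im ≠ 0)
    (hA : A = -(2 * β.re + α)) (hB : B = β.re ^ 2 + β.im ^ 2 + 2 * β.re * α)
    (hw : w = a + b * β + c * β ^ 2) :
    |c * α + c * A - b| = |w.im| / |β.im| ∧
      |c * α ^ 2 + c * B + A * (c * α) - a| ≤ ‖w‖ * (1 + |β.re| / |β.im|) := by
  have hwim : w.im = -(β.im * (c * α + c * A - b)) := by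
    rw [hw, hA]
    simp [pow_two]
    ring
  have hwre : c * α ^ 2 + c * B + A * (c * α) - a
      = -w.re - β.re * (c * α + c * A - b) := by
    rw [hw, hA, hB]
    simp [pow_two]
    ring
  have h1 : |c * α + c * A - b| = |w.im| / |β.im| := by
    rw [hwim, abs_neg, abs_mul, mul_div_cancel_left₀ _ (abs_ne_zero.2 him)]
  refine ⟨h1, ?_⟩
  rw [hwre]
  calc |-w.re - β.re * (c * α + c * A - b)|
      ≤ |w.re| + |β.re| * (|w.im| / |β.im|) := by
        rw [← h1, ← abs_mul, ← abs_neg w.re]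
        exact abs_sub _ _
    _ ≤ ‖w‖ + |β.re| * (‖w‖ / |β.im|) := by
        gcongr
        · exact Complex.abs_re_le_norm w
        · exact Complex.abs_im_le_norm w
    _ = _ := by ring

theorem exists_nat_mul_eq_intCast_pair (A B : ℚ) :
    ∃ (N : ℕ) (A' B' : ℤ), 0 < N ∧ (N : ℝ) * A = A' ∧ (N : ℝ) * B = B' := by
  refine ⟨A.den * B.den, A.num * B.den, B.num * A.den, by positivity, ?_, ?_⟩
  · have h : (A.num : ℝ) = A * A.den := by exact_mod_cast (Rat.mul_den_eq_num A).symm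
    push_cast
    rw [h]
    ring
  · have h : (B.num : ℝ) = B * B.den := by exact_mod_cast (Rat.mul_den_eq_num B).symm
    push_cast
    rw [h]
    ring

/-- The integer coordinates of the powers of a unit give simultaneous approximations. -/
theorem exists_simultaneous_approximations {α E : ℝ} {β z : ℂ} {A B : ℚ} {D : ℕ}
    (him : β.im ≠ 0) (hA : (A : ℝ) = -(2 * β.re + α))
    (hB : (B : ℝ) = β.re ^ 2 + β.im ^ 2 + 2 * β.re * α)
    (hE : 1 < E) (hz : ‖z‖ ≤ 1) (hD : 0 < D)
    (hrep : ∀ n : ℕ, ∃ a b c : ℤ, (D : ℝ) * E ^ n = a + b * α + c * α ^ 2 ∧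
      (D : ℂ) * z ^ n = a + b * β + c * β ^ 2) :
    ∃ (S : ℕ → ℕ) (n₀ : ℕ) (C : ℝ), 0 < C ∧ 1 ≤ n₀ ∧
      (∀ n, n₀ ≤ n → 2 ≤ S n ∧ S n < S (n + 1) ∧ (S n : ℝ) ≤ C * E ^ n) ∧
      (∀ n, n₀ ≤ n → distNearestInt (S n * α) ≤ C * |(z ^ n).im|) ∧
      (∀ n, n₀ ≤ n → distNearestInt (S n * α ^ 2) ≤ C * ‖z‖ ^ n) := by
  choose a b c hE' hz' using hrep
  obtain ⟨N, A', B', hN, hA', hB'⟩ := exists_nat_mul_eq_intCast_pair A B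
  have hDpos : (0 : ℝ) < D := by exact_mod_cast hD
  have hy : 0 < |β.im| := abs_pos.2 him
  set δ : ℕ → ℝ := fun n => c n * α + c n * A - b n with hδ
  set η : ℕ → ℝ := fun n => c n * α ^ 2 + c n * B + A * (c n * α) - a n with hη
  set F : ℝ := (α - β.re) ^ 2 + β.im ^ 2 with hF
  have hFpos : 0 < F := by positivity
  have hest (n : ℕ) := abs_coord_error_le (a := a n) (b := b n) (c := c n) (w := D * z ^ n) him hA hB
    (by exact_mod_cast hz' n)
  have hδle (n : ℕ) : |δ n| ≤ D / |β.im| * |(z ^ n).im| := by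
    refine (hest n).1.le.trans_eq ?_
    rw [← Complex.ofReal_natCast, Complex.im_ofReal_mul, abs_mul, abs_of_pos hDpos]
    ring
  have hηle (n : ℕ) : |η n| ≤ D * (1 + |β.re| / |β.im|) * ‖z‖ ^ n := by
    refine (hest n).2.trans_eq ?_
    rw [norm_mul, norm_pow, Complex.norm_natCast]
    ring
  have him_le (n : ℕ) : |(z ^ n).im| ≤ ‖z‖ ^ n :=
    (Complex.abs_im_le_norm _).trans_eq (norm_pow z n)
  have hδle' (n : ℕ) : |δ n| ≤ D / |β.im| * ‖z‖ ^ n :=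
    (hδle n).trans (by gcongr; exact him_le n)
  have hpow (n : ℕ) : ‖z‖ ^ n ≤ 1 := pow_le_one₀ (norm_nonneg z) hz
  set C₁ : ℝ := D / |β.im| with hC₁
  set C₂ : ℝ := D * (1 + |β.re| / |β.im|) with hC₂
  have hC₁pos : 0 < C₁ := by positivity
  have hC₂pos : 0 < C₂ := by positivity
  set C₃ : ℝ := C₂ + |α| * C₁ with hC₃
  have hC₃pos : 0 < C₃ := by positivity
  have hc (n : ℕ) : |c n * F - D * E ^ n| ≤ C₃ := by
    have h : c n * F - D * E ^ n = η n + α * δ n := by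
      rw [hE', hη, hδ, hF]
      simp only [hA, hB]
      ring
    rw [h]
    calc |η n + α * δ n| ≤ |η n| + |α| * |δ n| := by rw [← abs_mul]; exact abs_add_le _ _
      _ ≤ C₂ * 1 + |α| * (C₁ * 1) := by
        gcongr
        · exact (hηle n).trans (by gcongr; exact hpow n)
        · exact (hδle' n).trans (by gcongr; exact hpow n)
      _ = C₃ := by rw [hC₃]; ring
  obtain ⟨n₀, hn₀, hn₀1⟩ : ∃ n₀ : ℕ, (∀ n, n₀ ≤ n → 2 * F + C₃ < D * E ^ n ∧
      2 * C₃ < D * E ^ n * (E - 1)) ∧ 1 ≤ n₀ := by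
    have ht := tendsto_pow_atTop_atTop_of_one_lt hE
    have h1 := (ht.const_mul_atTop hDpos).eventually_gt_atTop (2 * F + C₃)
    have h2 := ((ht.const_mul_atTop hDpos).atTop_mul_const (sub_pos.2 hE)).eventually_gt_atTop
      (2 * C₃)
    obtain ⟨n₁, hn₁⟩ := Filter.eventually_atTop.1 (h1.and h2)
    exact ⟨n₁ + 1, fun n hn => hn₁ n (by omega), by omega⟩
  have hc2 (n : ℕ) (hn : n₀ ≤ n) : 2 ≤ c n := by
    have h := (abs_le.1 (hc n)).1
    have h' := (hn₀ n hn).1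
    have : (2 : ℝ) < c n := lt_of_mul_lt_mul_right (by linarith) hFpos.le
    exact_mod_cast this.le
  have hclt (n : ℕ) (hn : n₀ ≤ n) : c n < c (n + 1) := by
    have h := (abs_le.1 (hc n)).2
    have h1 := (abs_le.1 (hc (n + 1))).1
    have h' := (hn₀ n hn).2
    rw [pow_succ] at h1
    have : (c n : ℝ) < c (n + 1) := lt_of_mul_lt_mul_right (by linarith) hFpos.le
    exact_mod_cast this
  have hcast (n : ℕ) (hn : n₀ ≤ n) : ((N ^ 2 * (c n).toNat : ℕ) : ℝ) = N ^ 2 * c n := by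
    have : (((c n).toNat : ℤ) : ℝ) = c n := by
      rw [Int.toNat_of_nonneg (by linarith [hc2 n hn])]
    push_cast at this ⊢
    rw [this]
  set C₄ : ℝ := N ^ 2 * ((D + C₃) / F) with hC₄
  set C₅ : ℝ := N ^ 2 * C₂ + |(A' : ℝ)| * N * C₁ with hC₅
  have hNpos : (0 : ℝ) < N := by exact_mod_cast hN
  have hC₄pos : 0 < C₄ := by positivity
  have hC₅pos : 0 < C₅ := by positivity
  have hδint (n : ℕ) : N * (c n * α) = N * δ n + ((N * b n - c n * A' : ℤ) : ℝ) := by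
    push_cast
    rw [← hA', hδ]
    ring
  refine ⟨fun n => N ^ 2 * (c n).toNat, n₀, C₄ + N ^ 2 * C₁ + C₅, by positivity, hn₀1,
    fun n hn => ⟨?_, ?_, ?_⟩, fun n hn => ?_, fun n hn => ?_⟩
  · have h2 : 2 ≤ (c n).toNat := by have := hc2 n hn; omega
    exact h2.trans (Nat.le_mul_of_pos_left _ (by positivity))
  · have h2 : (c n).toNat < (c (n + 1)).toNat := by
      have := hc2 n hn
      have := hclt n hn
      omega
    exact Nat.mul_lt_mul_of_pos_left h2 (by positivity)
  · rw [hcast n hn]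
    have h := (abs_le.1 (hc n)).2
    have h1 : 1 ≤ E ^ n := one_le_pow₀ hE.le
    have h2 : (c n : ℝ) ≤ (D + C₃) / F * E ^ n := by
      rw [div_mul_eq_mul_div, le_div_iff₀ hFpos]
      nlinarith
    calc (N : ℝ) ^ 2 * c n ≤ N ^ 2 * ((D + C₃) / F * E ^ n) := by gcongr
      _ = C₄ * E ^ n := by rw [hC₄]; ring
      _ ≤ (C₄ + N ^ 2 * C₁ + C₅) * E ^ n := by
        gcongr
        nlinarith [mul_pos (pow_pos hNpos 2) hC₁pos]
  · rw [hcast n hn]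
    refine (distNearestInt_le _ (N * (N * b n - c n * A'))).trans ?_
    have h : N ^ 2 * c n * α - ((N * (N * b n - c n * A') : ℤ) : ℝ) = N ^ 2 * δ n := by
      have := hδint n
      push_cast at this ⊢
      linear_combination N * this
    rw [h, abs_mul, abs_of_pos (by positivity)]
    calc (N : ℝ) ^ 2 * |δ n| ≤ N ^ 2 * (C₁ * |(z ^ n).im|) := by gcongr; exact hδle n
      _ = N ^ 2 * C₁ * |(z ^ n).im| := by ring
      _ ≤ _ := by gcongr; linarith
  · rw [hcast n hn]
    refine (distNearestInt_le _
      (N ^ 2 * a n - N * c n * B' - A' * (N * b n - c n * A'))).trans ?_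
    have h : N ^ 2 * c n * α ^ 2
        - ((N ^ 2 * a n - N * c n * B' - A' * (N * b n - c n * A') : ℤ) : ℝ)
        = N ^ 2 * η n - A' * N * δ n := by
      have := hδint n
      push_cast at this ⊢
      simp only [hη]
      linear_combination -(A' * this) - (N * c n) * hB' - N * (c n * α) * hA'
    rw [h]
    calc |N ^ 2 * η n - A' * N * δ n| ≤ |N ^ 2 * η n| + |A' * N * δ n| := abs_sub _ _
      _ = N ^ 2 * |η n| + |(A' : ℝ)| * N * |δ n| := by
        rw [abs_mul, abs_mul, abs_mul, abs_of_pos (pow_pos hNpos 2), abs_of_pos hNpos]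
      _ ≤ N ^ 2 * (C₂ * ‖z‖ ^ n) + |(A' : ℝ)| * N * (C₁ * ‖z‖ ^ n) := by
        gcongr
        · exact hηle n
        · exact hδle' n
      _ = C₅ * ‖z‖ ^ n := by rw [hC₅]; ring
      _ ≤ _ := by
        gcongr
        nlinarith [mul_pos (pow_pos hNpos 2) hC₁pos]

/-- A sequence of geometric growth whose approximation errors are governed by the powers of a
complex number of matching modulus is a Peck sequence. -/
theorem exists_peck_sequence_of_geometric {σ τ E C : ℝ} {z : ℂ} {S : ℕ → ℕ} {n₀ : ℕ}
    (hE : 1 < E) (hzE : ‖z‖ ^ 2 * E = 1) (hC : 0 < C) (hn₀ : 1 ≤ n₀)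
    (hS : ∀ n, n₀ ≤ n → 2 ≤ S n ∧ S n < S (n + 1) ∧ (S n : ℝ) ≤ C * E ^ n)
    (hσ : ∀ n, n₀ ≤ n → distNearestInt (S n * σ) ≤ C * |(z ^ n).im|)
    (hτ : ∀ n, n₀ ≤ n → distNearestInt (S n * τ) ≤ C * ‖z‖ ^ n) :
    ∃ (s : ℕ → ℕ) (M₁ M₂ : ℝ) (j : ℕ → ℕ),
      StrictMono s ∧ (∀ n, 0 < s n) ∧ 0 < M₁ ∧ 0 < M₂ ∧ StrictMono j ∧
      (∀ n, 2 ≤ s (j n)) ∧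
      (∀ n, max (distNearestInt ((s n : ℝ) * σ)) (distNearestInt ((s n : ℝ) * τ))
          < M₁ / Real.sqrt (s n)) ∧
      (∀ n, distNearestInt ((s (j n) : ℝ) * σ)
          < M₂ / (Real.sqrt (s (j n)) * Real.log (s (j n)))) := by
  have hE0 : 0 < E := one_pos.trans hE
  have hsqrt (m : ℕ) (hm : n₀ ≤ m) : ‖z‖ ^ m * √(S m) ≤ √C := by
    calc ‖z‖ ^ m * √(S m) ≤ ‖z‖ ^ m * √(C * E ^ m) := by gcongr; exact (hS m hm).2.2
      _ = √((‖z‖ ^ m) ^ 2 * (C * E ^ m)) := by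
        rw [Real.sqrt_mul (sq_nonneg _), Real.sqrt_sq (by positivity)]
      _ = √C := by
        congr 1
        calc (‖z‖ ^ m) ^ 2 * (C * E ^ m) = C * (‖z‖ ^ 2 * E) ^ m := by ring
          _ = C := by rw [hzE, one_pow, mul_one]
  have hlog (m : ℕ) (hm : n₀ ≤ m) : Real.log (S m) ≤ (|Real.log C| + Real.log E) * m := by
    have hSpos : (0 : ℝ) < S m := by exact_mod_cast two_pos.trans_le (hS m hm).1
    have hm1 : (1 : ℝ) ≤ m := by exact_mod_cast hn₀.trans hm
    calc Real.log (S m) ≤ Real.log (C * E ^ m) := Real.log_le_log hSpos (hS m hm).2.2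
      _ = Real.log C + m * Real.log E := by
        rw [Real.log_mul hC.ne' (by positivity), Real.log_pow]
      _ ≤ _ := by nlinarith [le_abs_self (Real.log C), abs_nonneg (Real.log C)]
  have hlogE : 0 < Real.log E := Real.log_pos hE
  obtain ⟨j, hj, hjle⟩ : ∃ j : ℕ → ℕ, StrictMono j ∧ ∀ n,
      |(z ^ (j n + n₀)).im| ≤ Real.pi * ‖z‖ ^ (j n + n₀) / (j n + n₀ : ℕ) := by
    refine Filter.extraction_of_frequently_atTop (P := fun m => |(z ^ (m + n₀)).im|
      ≤ Real.pi * ‖z‖ ^ (m + n₀) / (m + n₀ : ℕ)) (Filter.frequently_atTop.2 fun T => ?_)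
    obtain ⟨m, hm, hle⟩ := Filter.frequently_atTop.1 (Complex.frequently_abs_im_pow_le z) (T + n₀)
    refine ⟨m - n₀, by omega, ?_⟩
    rwa [Nat.sub_add_cancel (by omega)]
  have hS2 (n : ℕ) : 2 ≤ S (n + n₀) := (hS _ (by omega)).1
  have hSpos (n : ℕ) : (0 : ℝ) < S (n + n₀) := by exact_mod_cast two_pos.trans_le (hS2 n)
  set L := |Real.log C| + Real.log E with hL
  have hLpos : 0 < L := by positivity
  refine ⟨fun n => S (n + n₀), C * √C + 1, C * Real.pi * √C * L + 1, j,
    strictMono_nat_of_lt_succ fun n => ?_, fun n => two_pos.trans_le (hS2 n), by positivity,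
    by positivity, hj, fun n => hS2 _, fun n => ?_, fun n => ?_⟩
  · have h := (hS (n + n₀) (by omega)).2.1
    rwa [add_right_comm] at h
  · have hle : n₀ ≤ n + n₀ := by omega
    rw [lt_div_iff₀ (Real.sqrt_pos.2 (hSpos n))]
    have h1 : max (distNearestInt ((S (n + n₀) : ℝ) * σ)) (distNearestInt ((S (n + n₀) : ℝ) * τ))
        ≤ C * ‖z‖ ^ (n + n₀) := by
      refine max_le ((hσ _ hle).trans ?_) (hτ _ hle)
      gcongr
      exact (Complex.abs_im_le_norm _).trans_eq (norm_pow _ _)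
    calc _ ≤ C * ‖z‖ ^ (n + n₀) * √(S (n + n₀)) := by gcongr
      _ = C * (‖z‖ ^ (n + n₀) * √(S (n + n₀))) := by ring
      _ ≤ C * √C := by gcongr; exact hsqrt _ hle
      _ < _ := lt_add_one _
  · set m := j n + n₀ with hm
    have hle : n₀ ≤ m := by omega
    have hm0 : (0 : ℝ) < m := by exact_mod_cast hn₀.trans hle
    have hlogpos : 0 < Real.log (S m) := Real.log_pos (by exact_mod_cast hS2 (j n))
    rw [lt_div_iff₀ (mul_pos (Real.sqrt_pos.2 (hSpos (j n))) hlogpos)]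
    calc distNearestInt (S m * σ) * (√(S m) * Real.log (S m))
        ≤ C * (Real.pi * ‖z‖ ^ m / m) * (√(S m) * (L * m)) := by
          gcongr
          · exact (hσ m hle).trans (by gcongr; exact hjle n)
          · exact hlog m hle
      _ = C * Real.pi * (‖z‖ ^ m * √(S m)) * L := by field_simp
      _ ≤ C * Real.pi * √C * L := by gcongr; exact hsqrt m hle
      _ < _ := lt_add_one _

/-- **Theorem 2.** If `α` is the only real root of an irreducible cubic polynomial in `ℚ[x]`,
then there is a Peck sequence for the pair `(α, α²)`. -/
theorem peck_sequence_for_alpha_alphasq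
    (f : ℚ[X]) (hirr : Irreducible f) (hdeg : f.natDegree = 3)
    (α : ℝ)
    (hroot : Polynomial.aeval α f = 0)
    (huniq : ∀ x : ℝ, Polynomial.aeval x f = 0 → x = α) :
    ∃ (s : ℕ → ℕ) (M₁ M₂ : ℝ) (j : ℕ → ℕ),
      StrictMono s ∧ (∀ n, 0 < s n) ∧ 0 < M₁ ∧ 0 < M₂ ∧ StrictMono j ∧
      (∀ n, 2 ≤ s (j n)) ∧
      (∀ n, max (distNearestInt ((s n : ℝ) * α)) (distNearestInt ((s n : ℝ) * α ^ 2))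
          < M₁ / Real.sqrt (s n)) ∧
      (∀ n, distNearestInt ((s (j n) : ℝ) * α)
          < M₂ / (Real.sqrt (s (j n)) * Real.log (s (j n)))) := by
  obtain ⟨β, z, E, D, him, hβ, hE, hzE, hD, hrep⟩ :=
    exists_powers_of_complex_cubic f hirr hdeg α hroot huniq
  obtain ⟨A, B, hA, hB⟩ := quadratic_relation_of_cubic_roots f hdeg hroot hβ him
  have hz : ‖z‖ ≤ 1 := by
    by_contra! h
    nlinarith [one_lt_pow₀ h two_ne_zero]
  obtain ⟨S, n₀, C, hC, hn₀, hS, hσ, hτ⟩ :=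
    exists_simultaneous_approximations him hA hB hE hz hD hrep
  exact exists_peck_sequence_of_geometric hE hzE hC hn₀ hS hσ hτ
end

section
/- Suppose θ ∈ ℝ is the only real root of an irreducible polynomial x³ − p·x − q ∈ ℤ[x] and let K = ℚ(θ). Let x, y, z ∈ ℚ, not all zero, and set ζ = x + y·θ + z·θ² ∈ K (a nonzero real number). Then (2·(x + p·z) − y·θ − z·θ²)² + (3·θ² − 4·p)·(y − z·θ)² = 4·N_{K/ℚ}(ζ)/ζ, where N_{K/ℚ}(ζ) ∈ ℚ is the field norm of ζ. -/
open Polynomial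

section CubicPowerBasis

variable {F K : Type*} [Field F] [Field K] [Algebra F K]

/-- The norm of `x + y g + z g²` when `1, g, g²` is a basis and `g³ = p g + q`. -/
theorem norm_of_cubic_basis {p q : F} {g : K} (b : Module.Basis (Fin 3) F K)
    (hb : ∀ i, b i = g ^ (i : ℕ))
    (hg : g ^ 3 = algebraMap F K p * g + algebraMap F K q) (x y z : F) :
    Algebra.norm F (algebraMap F K x + algebraMap F K y * g + algebraMap F K z * g ^ 2) =
      !![x, q * z, q * y; y, x + p * z, q * z + p * y; z, y, x + p * z].det := by
  rw [Algebra.norm_eq_matrix_det b]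
  congr 1
  ext i j
  rw [Algebra.leftMulMatrix_eq_repr_mul]
  have key : (algebraMap F K x + algebraMap F K y * g + algebraMap F K z * g ^ 2) * b j =
      ∑ k, !![x, q * z, q * y; y, x + p * z, q * z + p * y; z, y, x + p * z] k j • b k := by
    fin_cases j <;> simp [hb, Fin.sum_univ_three, Algebra.smul_def]
    · linear_combination algebraMap F K z * hg
    · linear_combination (algebraMap F K y + algebraMap F K z * g) * hg
  rw [key, b.repr_sum_self]

/-- If `1, g, g²` is a basis, then `x + y g + z g² = 0` only for `x = y = z = 0`. -/
theorem eq_zero_of_cubic_basis {g : K} (b : Module.Basis (Fin 3) F K)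
    (hb : ∀ i, b i = g ^ (i : ℕ)) {x y z : F}
    (h : algebraMap F K x + algebraMap F K y * g + algebraMap F K z * g ^ 2 = 0) :
    x = 0 ∧ y = 0 ∧ z = 0 := by
  have key := Fintype.linearIndependent_iff.mp b.linearIndependent ![x, y, z]
    (by simpa [hb, Fin.sum_univ_three, Algebra.smul_def] using h)
  exact ⟨key 0, key 1, key 2⟩

end CubicPowerBasis

open IntermediateField in
/-- A root `θ` of an irreducible `X³ - p X - q` gives the basis `1, θ, θ²` of `F(θ)`. -/
theorem exists_basis_adjoin_cubic_root {F L : Type*} [Field F] [Field L] [Algebra F L]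
    {p q : F} {θ : L} (hirr : Irreducible (X ^ 3 - C p * X - C q))
    (hroot : aeval θ (X ^ 3 - C p * X - C q) = 0) :
    ∃ b : Module.Basis (Fin 3) F (adjoin F ({θ} : Set L)),
      ∀ i, b i = AdjoinSimple.gen F θ ^ (i : ℕ) := by
  have hmonic : (X ^ 3 - C p * X - C q).Monic := by monicity!
  have hdeg : (X ^ 3 - C p * X - C q).natDegree = 3 := by compute_degree!
  have hmin := minpoly.eq_of_irreducible_of_monic hirr hroot hmonic
  have hint : IsIntegral F θ := ⟨_, hmonic, by simpa [aeval_def] using hroot⟩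
  have hdim : (adjoin.powerBasis hint).dim = 3 := by
    rw [adjoin.powerBasis_dim, ← hmin, hdeg]
  refine ⟨(adjoin.powerBasis hint).basis.reindex (finCongr hdim), fun i => ?_⟩
  simp

/-- For `θ` the only real root of the irreducible `x³ - p x - q ∈ ℤ[x]`, `K = ℚ(θ)`, and
`ζ = x + yθ + zθ²` with `x, y, z ∈ ℚ` not all zero, one has `ζ ≠ 0` and
`(2(x + pz) - yθ - zθ²)² + (3θ² - 4p)(y - zθ)² = 4 N_{K/ℚ}(ζ)/ζ`. -/
theorem norm_identity_one
    (p q : ℤ) (θ : ℝ)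
    (hirr : Irreducible (X ^ 3 - C (p : ℚ) * X - C (q : ℚ)))
    (hroot : θ ^ 3 - (p : ℝ) * θ - (q : ℝ) = 0)
    (huniq : ∀ t : ℝ, t ^ 3 - (p : ℝ) * t - (q : ℝ) = 0 → t = θ)
    (x y z : ℚ) (hxyz : ¬(x = 0 ∧ y = 0 ∧ z = 0))
    (w : IntermediateField.adjoin ℚ ({θ} : Set ℝ))
    (hw : (w : ℝ) = (x : ℝ) + (y : ℝ) * θ + (z : ℝ) * θ ^ 2) :
    (w : ℝ) ≠ 0 ∧
    (2 * ((x : ℝ) + (p : ℝ) * (z : ℝ)) - (y : ℝ) * θ - (z : ℝ) * θ ^ 2) ^ 2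
        + (3 * θ ^ 2 - 4 * (p : ℝ)) * ((y : ℝ) - (z : ℝ) * θ) ^ 2
      = 4 * ((Algebra.norm ℚ w : ℚ) : ℝ) / (w : ℝ) := by
  obtain ⟨b, hb⟩ := exists_basis_adjoin_cubic_root (θ := θ) hirr (by simpa using hroot)
  set g := IntermediateField.AdjoinSimple.gen ℚ θ
  have hgθ : (g : ℝ) = θ := IntermediateField.AdjoinSimple.coe_gen ℚ θ
  have hg : g ^ 3 = algebraMap ℚ _ (p : ℚ) * g + algebraMap ℚ _ (q : ℚ) := by
    apply Subtype.ext
    simp only [map_intCast]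
    push_cast [hgθ]
    linear_combination hroot
  have hwg : w = algebraMap ℚ _ x + algebraMap ℚ _ y * g + algebraMap ℚ _ z * g ^ 2 := by
    apply Subtype.ext
    simp only [eq_ratCast]
    push_cast [hgθ]
    exact hw
  have hw0 : (w : ℝ) ≠ 0 := fun h =>
    hxyz (eq_zero_of_cubic_basis b hb (hwg.symm.trans (Subtype.ext h)))
  refine ⟨hw0, ?_⟩
  rw [eq_div_iff hw0, hwg, norm_of_cubic_basis b hb hg, ← hwg, hw, Matrix.det_fin_three]
  simp
  linear_combination (4 * (y : ℝ) ^ 3 - 12 * x * y * z - 4 * p * y * z ^ 2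
    + 4 * z ^ 3 * (θ ^ 3 - p * θ + q)) * hroot
end

section
/- Suppose θ ∈ ℝ is the only real root of an irreducible polynomial x³ − p·x − q ∈ ℤ[x] and let K = ℚ(θ). Let x, y, z ∈ ℚ, not all zero, and set ζ = x + y·θ + z·θ² ∈ K (a nonzero real number). Then (x + p·z − y·θ)² + (x + p·z − z·θ²)² + (1 − 2·p/θ²)·(y·θ − z·θ²)² = 2·N_{K/ℚ}(ζ)/ζ, where N_{K/ℚ}(ζ) ∈ ℚ is the field norm of ζ. -/
open Polynomial

/-- The norm of `x + y t + z t²` in a cubic extension with basis `1, t, t²`, where `t³ = p t + q`. -/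
theorem norm_eq_of_cubic_basis {F K : Type*} [Field F] [Field K] [Algebra F K]
    (b : Module.Basis (Fin 3) F K) {t : K} (hb : ∀ i, b i = t ^ (i : ℕ)) {p q : F}
    (ht : t ^ 3 = p • t + algebraMap F K q) (x y z : F) :
    Algebra.norm F (algebraMap F K x + y • t + z • t ^ 2) =
      (!![x, q * z, q * y; y, x + p * z, q * z + p * y; z, y, x + p * z] :
        Matrix (Fin 3) (Fin 3) F).det := by
  rw [Algebra.norm_eq_matrix_det b]
  congr 1
  ext i j
  have key : ∀ c : Fin 3 → F,
      (algebraMap F K x + y • t + z • t ^ 2) * b j = ∑ k, c k • b k →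
      Algebra.leftMulMatrix b (algebraMap F K x + y • t + z • t ^ 2) i j = c i := by
    intro c hc
    rw [Algebra.leftMulMatrix_eq_repr_mul, hc, b.repr_sum_self]
  rw [key fun k => !![x, q * z, q * y; y, x + p * z, q * z + p * y; z, y, x + p * z] k j]
  simp only [Fin.sum_univ_three, hb, Algebra.smul_def] at ht ⊢
  fin_cases j <;> simp
  · linear_combination algebraMap F K z * ht
  · linear_combination (algebraMap F K y + algebraMap F K z * t) * ht

/-- The powers `1, t, t²` of a root `t` of an irreducible monic cubic form a basis of `F(t)`. -/
theorem exists_basis_adjoin_of_cubic {F E : Type*} [Field F] [Field E] [Algebra F E] {f : F[X]}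
    (hirr : Irreducible f) (hmonic : f.Monic) (hdeg : f.natDegree = 3) {t : E}
    (hroot : aeval t f = 0) :
    ∃ b : Module.Basis (Fin 3) F (IntermediateField.adjoin F ({t} : Set E)),
      ∀ i, b i = IntermediateField.AdjoinSimple.gen F t ^ (i : ℕ) := by
  have hint : IsIntegral F t := ⟨f, hmonic, hroot⟩
  have hdim : (IntermediateField.adjoin.powerBasis hint).dim = 3 := by
    rw [IntermediateField.adjoin.powerBasis_dim,
      ← minpoly.eq_of_irreducible_of_monic hirr hroot hmonic, hdeg]
  exact ⟨(IntermediateField.adjoin.powerBasis hint).basis.reindex (finCongr hdim),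
    fun i => by simp⟩

/-- For `θ` the only real root of the irreducible `x³ - p x - q ∈ ℤ[x]`, `K = ℚ(θ)`, and
`ζ = x + yθ + zθ²` with `x, y, z ∈ ℚ` not all zero, one has `ζ ≠ 0` and
`(x + pz - yθ)² + (x + pz - zθ²)² + (1 - 2p/θ²)(yθ - zθ²)² = 2 N_{K/ℚ}(ζ)/ζ`. -/
theorem norm_identity_two
    (p q : ℤ) (θ : ℝ)
    (hirr : Irreducible (X ^ 3 - C (p : ℚ) * X - C (q : ℚ)))
    (hroot : θ ^ 3 - (p : ℝ) * θ - (q : ℝ) = 0)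
    (huniq : ∀ t : ℝ, t ^ 3 - (p : ℝ) * t - (q : ℝ) = 0 → t = θ)
    (x y z : ℚ) (hxyz : ¬(x = 0 ∧ y = 0 ∧ z = 0))
    (w : IntermediateField.adjoin ℚ ({θ} : Set ℝ))
    (hw : (w : ℝ) = (x : ℝ) + (y : ℝ) * θ + (z : ℝ) * θ ^ 2) :
    (w : ℝ) ≠ 0 ∧
    ((x : ℝ) + (p : ℝ) * (z : ℝ) - (y : ℝ) * θ) ^ 2
        + ((x : ℝ) + (p : ℝ) * (z : ℝ) - (z : ℝ) * θ ^ 2) ^ 2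
        + (1 - 2 * (p : ℝ) / θ ^ 2) * ((y : ℝ) * θ - (z : ℝ) * θ ^ 2) ^ 2
      = 2 * ((Algebra.norm ℚ w : ℚ) : ℝ) / (w : ℝ) := by
  have hdeg : (X ^ 3 - C (p : ℚ) * X - C (q : ℚ)).natDegree = 3 := by compute_degree!
  have hmonic : (X ^ 3 - C (p : ℚ) * X - C (q : ℚ)).Monic := by monicity!
  obtain ⟨b, hb⟩ := exists_basis_adjoin_of_cubic hirr hmonic hdeg (t := θ) (by simpa using hroot)
  set t := IntermediateField.AdjoinSimple.gen ℚ θ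
  have ht_coe : (t : ℝ) = θ := IntermediateField.AdjoinSimple.coe_gen ℚ θ
  have hwt : w = algebraMap ℚ _ x + y • t + z • t ^ 2 := by
    apply Subtype.ext
    simp [hw, ht_coe, Algebra.smul_def]
  have ht : t ^ 3 = (p : ℚ) • t + algebraMap ℚ _ (q : ℚ) := by
    apply Subtype.ext
    simp [ht_coe, Algebra.smul_def]
    linear_combination hroot
  have hw0 : (w : ℝ) ≠ 0 := by
    intro h
    have hsum : ∑ i, ![x, y, z] i • b i = 0 := by
      have hw_zero : w = 0 := Subtype.ext h
      simp only [Fin.sum_univ_three, hb]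
      simpa [hwt, Algebra.smul_def] using hw_zero
    have hcoeff := Fintype.linearIndependent_iff.mp b.linearIndependent _ hsum
    exact hxyz ⟨hcoeff 0, hcoeff 1, hcoeff 2⟩
  have hθ : θ ≠ 0 := by
    rintro rfl
    have h0 : t = 0 := Subtype.ext ht_coe
    exact b.ne_zero 1 (by simp [hb, h0])
  refine ⟨hw0, ?_⟩
  rw [eq_div_iff hw0, hw, hwt, norm_eq_of_cubic_basis b hb ht, Matrix.det_fin_three]
  simp
  have hq : (q : ℝ) = θ ^ 3 - p * θ := by linear_combination -hroot
  rw [hq]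
  field_simp
  ring
end

section
/- With the setup below, for every positive integer n the following four inequalities hold: (i) |aₙ + p·cₙ − bₙ·θ| < C₁/λ^(n/2); (ii) |aₙ + p·cₙ − cₙ·θ²| < C₁/λ^(n/2); (iii) |bₙ·θ − cₙ·θ²| < (2|θ|/√(3θ² − 4p))·λ^(−n/2) ≤ √2·C₁/λ^(n/2); and (iv) |λⁿ − (3·θ² − p)·cₙ| < (1 + √2)·C₁/λ^(n/2). -/
open Polynomial

/-- If an irreducible monic cubic over `ℚ` vanishes at `θ`, the rational coordinates of
`x + y θ + z θ² = 0` all vanish. -/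
lemma coords_eq_zero_of_irreducible_cubic {p q : ℚ} {θ : ℝ}
    (hirr : Irreducible (X ^ 3 - C p * X - C q))
    (hroot : θ ^ 3 - (p : ℝ) * θ - (q : ℝ) = 0) {x y z : ℚ}
    (h : (x : ℝ) + y * θ + z * θ ^ 2 = 0) : x = 0 ∧ y = 0 ∧ z = 0 := by
  have hmonic : (X ^ 3 - C p * X - C q : ℚ[X]).Monic := by monicity!
  have hdeg : (X ^ 3 - C p * X - C q : ℚ[X]).degree = 3 := by compute_degree!
  have hmin : X ^ 3 - C p * X - C q = minpoly ℚ θ :=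
    minpoly.eq_of_irreducible_of_monic hirr (by simpa using hroot) hmonic
  have hzero : C z * X ^ 2 + C y * X + C x = 0 := by
    by_contra hne
    have hle := minpoly.degree_le_of_ne_zero ℚ θ hne (by simp; linarith)
    rw [← hmin, hdeg] at hle
    exact absurd (hle.trans degree_quadratic_le) (by decide)
  have h0 := congrArg (coeff · 0) hzero
  have h1 := congrArg (coeff · 1) hzero
  have h2 := congrArg (coeff · 2) hzero
  simp [coeff_X, coeff_C] at h0 h1 h2
  exact ⟨h0, h1, h2⟩

/-- A positive rational that is an algebraic integer together with its inverse equals `1`. -/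
lemma rat_eq_one_of_isIntegral_of_isIntegral_inv {r : ℚ} (hpos : 0 < r)
    (hr : IsIntegral ℤ r) (hr' : IsIntegral ℤ r⁻¹) : r = 1 := by
  obtain ⟨k, hk⟩ := IsIntegrallyClosed.isIntegral_iff.mp hr
  obtain ⟨l, hl⟩ := IsIntegrallyClosed.isIntegral_iff.mp hr'
  simp only [algebraMap_int_eq, eq_intCast] at hk hl
  have hkl : k * l = 1 := by
    have : (k : ℚ) * l = 1 := by rw [hk, hl, mul_inv_cancel₀ hpos.ne']
    exact_mod_cast this
  have hk0 : 0 < k := by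
    rw [← hk] at hpos
    exact_mod_cast hpos
  rw [← hk, Int.eq_one_of_mul_eq_one_right hk0.le hkl, Int.cast_one]

/-- Integrality passes from `x + y θ + z θ²` and its inverse to the conjugate obtained by
replacing `θ` with another root `τ` of its irreducible cubic. -/
lemma isIntegral_conjugate {p q : ℚ} {θ : ℝ} {τ : ℂ}
    (hirr : Irreducible (X ^ 3 - C p * X - C q))
    (hroot : θ ^ 3 - (p : ℝ) * θ - (q : ℝ) = 0)
    (hτ : τ ^ 3 - (p : ℂ) * τ - (q : ℂ) = 0) {x y z : ℚ}
    (h : IsIntegral ℤ ((x : ℝ) + y * θ + z * θ ^ 2))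
    (h' : IsIntegral ℤ ((x : ℝ) + y * θ + z * θ ^ 2)⁻¹) :
    IsIntegral ℤ ((x : ℂ) + y * τ + z * τ ^ 2) ∧
      IsIntegral ℤ ((x : ℂ) + y * τ + z * τ ^ 2)⁻¹ := by
  have : Fact (Irreducible (X ^ 3 - C p * X - C q)) := ⟨hirr⟩
  let φ : AdjoinRoot (X ^ 3 - C p * X - C q) →+* ℝ :=
    AdjoinRoot.lift (algebraMap ℚ ℝ) θ (by simpa using hroot)
  let ψ : AdjoinRoot (X ^ 3 - C p * X - C q) →+* ℂ :=
    AdjoinRoot.lift (algebraMap ℚ ℂ) τ (by simpa using hτ)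
  let w : AdjoinRoot (X ^ 3 - C p * X - C q) :=
    AdjoinRoot.mk _ (C x + C y * X + C z * X ^ 2)
  have hφ : φ w = (x : ℝ) + y * θ + z * θ ^ 2 := by
    simp only [φ, w, AdjoinRoot.lift_mk]
    simp
  have hψ : ψ w = (x : ℂ) + y * τ + z * τ ^ 2 := by
    simp only [ψ, w, AdjoinRoot.lift_mk]
    simp
  rw [← hφ] at h h'
  rw [← map_inv₀] at h'
  rw [← hψ, ← map_inv₀]
  have key : ∀ v, IsIntegral ℤ (φ v) → IsIntegral ℤ (ψ v) := fun v hv =>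
    ((isIntegral_algHom_iff φ.toIntAlgHom φ.injective).mp hv).map ψ.toIntAlgHom
  exact ⟨key _ h, key _ h'⟩

/-- Writing a positive unit as `x + y θ + z θ²`, the squared modulus of its non-real conjugate,
a quadratic form in `x + p z - z θ²` and `y - z θ`, is the inverse of the unit. -/
lemma unit_mul_conjugate_normSq {p q : ℚ} {θ : ℝ}
    (hirr : Irreducible (X ^ 3 - C p * X - C q))
    (hroot : θ ^ 3 - (p : ℝ) * θ - (q : ℝ) = 0)
    (hdisc : 0 < 3 * θ ^ 2 - 4 * (p : ℝ)) {x y z : ℚ}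
    (hpos : 0 < (x : ℝ) + y * θ + z * θ ^ 2)
    (h : IsIntegral ℤ ((x : ℝ) + y * θ + z * θ ^ 2))
    (h' : IsIntegral ℤ ((x : ℝ) + y * θ + z * θ ^ 2)⁻¹) :
    ((x : ℝ) + y * θ + z * θ ^ 2) *
      (((x + p * z - z * θ ^ 2) - (y - z * θ) * θ / 2) ^ 2 +
        (y - z * θ) ^ 2 * (3 * θ ^ 2 - 4 * p) / 4) = 1 := by
  set L : ℝ := (x : ℝ) + y * θ + z * θ ^ 2 with hL
  set D : ℝ := ((x + p * z - z * θ ^ 2) - (y - z * θ) * θ / 2) ^ 2 +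
        (y - z * θ) ^ 2 * (3 * θ ^ 2 - 4 * p) / 4 with hD
  set s := √(3 * θ ^ 2 - 4 * (p : ℝ)) with hs
  have hs2 : (s : ℂ) ^ 2 = 3 * θ ^ 2 - 4 * p := by
    have : s ^ 2 = 3 * θ ^ 2 - 4 * p := Real.sq_sqrt hdisc.le
    exact_mod_cast congrArg (fun t : ℝ => (t : ℂ)) this
  have hroot' : (θ : ℂ) ^ 3 - p * θ - q = 0 := by
    exact_mod_cast congrArg (fun t : ℝ => (t : ℂ)) hroot
  have hI := Complex.I_sq
  let τ : ℂ := (-θ + s * Complex.I) / 2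
  let σ : ℂ := (-θ - s * Complex.I) / 2
  have hquad : ∀ t : ℂ, t ^ 2 + θ * t + (θ ^ 2 - p) = 0 → t ^ 3 - p * t - q = 0 := fun t ht => by
    linear_combination (t - θ) * ht + hroot'
  have hτ : τ ^ 2 + θ * τ + (θ ^ 2 - p) = 0 := by
    simp only [τ]; linear_combination (s ^ 2 / 4 : ℂ) * hI - hs2 / 4
  have hσ : σ ^ 2 + θ * σ + (θ ^ 2 - p) = 0 := by
    simp only [σ]; linear_combination (s ^ 2 / 4 : ℂ) * hI - hs2 / 4
  obtain ⟨hm, hm'⟩ := isIntegral_conjugate hirr hroot (hquad τ hτ) h h'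
  obtain ⟨hk, hk'⟩ := isIntegral_conjugate hirr hroot (hquad σ hσ) h h'
  have hprod : ((x : ℂ) + y * τ + z * τ ^ 2) * ((x : ℂ) + y * σ + z * σ ^ 2) = (D : ℂ) := by
    have e1 : (x : ℂ) + y * τ + z * τ ^ 2 =
        ((x + p * z - z * θ ^ 2) - (y - z * θ) * θ / 2) + (y - z * θ) * s / 2 * Complex.I := by
      rw [eq_neg_of_add_eq_zero_left (a := τ ^ 2) (b := θ * τ + (θ ^ 2 - p))
        (by rw [← add_assoc]; exact hτ)]
      simp only [τ]; ring
    have e2 : (x : ℂ) + y * σ + z * σ ^ 2 =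
        ((x + p * z - z * θ ^ 2) - (y - z * θ) * θ / 2) - (y - z * θ) * s / 2 * Complex.I := by
      rw [eq_neg_of_add_eq_zero_left (a := σ ^ 2) (b := θ * σ + (θ ^ 2 - p))
        (by rw [← add_assoc]; exact hσ)]
      simp only [σ]; ring
    rw [e1, e2, hD]
    push_cast
    linear_combination (-((y - z * θ) * s / 2) ^ 2 : ℂ) * hI + ((y - z * θ) ^ 2 / 4 : ℂ) * hs2
  let r : ℚ := x ^ 3 + q * y ^ 3 + q ^ 2 * z ^ 3 + 2 * p * x ^ 2 * z - p * x * y ^ 2 +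
    p ^ 2 * x * z ^ 2 - 3 * q * x * y * z - p * q * y * z ^ 2
  have hr : L * D = r := by
    have hq : (q : ℝ) = θ ^ 3 - p * θ := by linarith
    simp only [hL, hD, r]
    push_cast
    rw [hq]
    ring
  have hrC : (L : ℂ) * (D : ℂ) = algebraMap ℚ ℂ r := by
    rw [← Complex.ofReal_mul, hr]; simp
  have hL1 : IsIntegral ℤ (L : ℂ) := h.map Complex.ofRealHom.toIntAlgHom
  have hL2 : IsIntegral ℤ (L : ℂ)⁻¹ := by
    rw [← Complex.ofReal_inv]; exact h'.map Complex.ofRealHom.toIntAlgHom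
  have hcast {v : ℚ} (hv : IsIntegral ℤ (algebraMap ℚ ℂ v)) : IsIntegral ℤ v :=
    (isIntegral_algHom_iff (algebraMap ℚ ℂ).toIntAlgHom (algebraMap ℚ ℂ).injective).mp hv
  have hr1 : IsIntegral ℤ r := hcast <| by
    rw [← hrC, ← hprod]; exact hL1.mul (hm.mul hk)
  have hr2 : IsIntegral ℤ r⁻¹ := hcast <| by
    rw [map_inv₀, ← hrC, ← hprod, mul_inv, mul_inv]; exact hL2.mul (hm'.mul hk')
  have hD0 : 0 ≤ D := by positivity
  have hDne : D ≠ 0 := by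
    intro hD00
    have hy : (y - z * θ : ℝ) ^ 2 * (3 * θ ^ 2 - 4 * p) / 4 = 0 := by
      refine le_antisymm ?_ (by positivity)
      rw [← hD00, hD]
      exact le_add_of_nonneg_left (sq_nonneg _)
    have hB : (y : ℝ) - z * θ = 0 := by
      rcases mul_eq_zero.mp ((div_eq_zero_iff.mp hy).resolve_right four_ne_zero) with h1 | h1
      · exact pow_eq_zero_iff two_ne_zero |>.mp h1
      · exact absurd h1 hdisc.ne'
    have hyz := coords_eq_zero_of_irreducible_cubic hirr hroot (x := y) (y := -z) (z := 0)
      (by push_cast; linarith)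
    have hz : z = 0 := neg_eq_zero.mp hyz.2.1
    rw [hD, hyz.1, hz] at hD00
    rw [hL, hyz.1, hz] at hpos
    simp at hD00 hpos
    exact hpos.ne' (by exact_mod_cast hD00)
  have hrpos : 0 < r := by
    have : (0 : ℝ) < r := hr ▸ mul_pos hpos (hD0.lt_of_ne' hDne)
    exact_mod_cast this
  rw [hr, rat_eq_one_of_isIntegral_of_isIntegral_inv hrpos hr1 hr2, Rat.cast_one]

/-- If `θ` is the only real root of an irreducible cubic, the quadratic cofactor has negative
discriminant. -/
lemma cofactor_discr_neg {p q : ℚ} {θ : ℝ}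
    (hirr : Irreducible (X ^ 3 - C p * X - C q))
    (hroot : θ ^ 3 - (p : ℝ) * θ - (q : ℝ) = 0)
    (huniq : ∀ x : ℝ, x ^ 3 - (p : ℝ) * x - (q : ℝ) = 0 → x = θ) :
    0 < 3 * θ ^ 2 - 4 * (p : ℝ) := by
  by_contra! hle
  have hs : √(4 * (p : ℝ) - 3 * θ ^ 2) ^ 2 = 4 * p - 3 * θ ^ 2 := Real.sq_sqrt (by linarith)
  set s := √(4 * (p : ℝ) - 3 * θ ^ 2)
  have h1 := huniq ((-θ + s) / 2) (by linear_combination ((-θ + s) / 2 - θ) / 4 * hs + hroot)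
  have h2 := huniq ((-θ - s) / 2) (by linear_combination ((-θ - s) / 2 - θ) / 4 * hs + hroot)
  have h3 := coords_eq_zero_of_irreducible_cubic hirr hroot (x := 0) (y := 1) (z := 0)
    (by push_cast; linarith)
  exact one_ne_zero h3.2.1

/-- Strict Cauchy-Schwarz type bound, for `t ≠ ±1`. -/
lemma abs_add_mul_lt {u v t M R : ℝ} (hR : 0 < R) (huv : R ^ 2 * (u ^ 2 + v ^ 2) = 1)
    (ht : t ^ 2 ≠ 1) (hM : M = max √2 (√2 * |t|)) : |u + v * t| < M / R := by
  have h2 : √2 ^ 2 = (2 : ℝ) := Real.sq_sqrt zero_le_two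
  have hM0 : 0 < M := hM ▸ lt_max_of_lt_left (by positivity)
  have hlt : 1 + t ^ 2 < M ^ 2 := by
    have hM1 : 2 ≤ M ^ 2 := by
      rw [← h2]; exact pow_le_pow_left₀ (by positivity) (hM ▸ le_max_left _ _) 2
    have hM2 : 2 * t ^ 2 ≤ M ^ 2 := by
      rw [← h2, ← sq_abs t, ← mul_pow]
      exact pow_le_pow_left₀ (by positivity) (hM ▸ le_max_right _ _) 2
    rcases lt_or_gt_of_ne ht with h | h <;> linarith
  rw [lt_div_iff₀ hR]
  refine lt_of_pow_lt_pow_left₀ 2 hM0.le ?_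
  rw [mul_pow, sq_abs]
  calc (u + v * t) ^ 2 * R ^ 2 ≤ (1 + t ^ 2) * (R ^ 2 * (u ^ 2 + v ^ 2)) := by
        nlinarith [sq_nonneg (R * (u * t - v))]
    _ < M ^ 2 := by rwa [huv, mul_one]

/-- **Lemma (bounds).** With `θ` the unique real root of the irreducible `x³ - p x - q ∈ ℤ[x]`,
`λ > 1` a unit of the ring of integers of `K = ℚ(θ)` (encoded: `λ` and `λ⁻¹` are integral
over `ℤ`), and `λⁿ = aₙ + bₙθ + cₙθ²` with rational coordinates, one has for every `n ≥ 1`: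
`|aₙ + p cₙ - bₙ θ| < C₁/λ^(n/2)`, `|aₙ + p cₙ - cₙ θ²| < C₁/λ^(n/2)`,
`|bₙ θ - cₙ θ²| < (2|θ|/√(3θ²-4p)) λ^(-n/2) ≤ √2 C₁/λ^(n/2)`, and
`|λⁿ - (3θ² - p) cₙ| < (1+√2) C₁/λ^(n/2)`. -/
theorem unit_power_coordinate_bounds
    (p q : ℤ) (θ : ℝ)
    (hirr : Irreducible (X ^ 3 - C (p : ℚ) * X - C (q : ℚ)))
    (hroot : θ ^ 3 - (p : ℝ) * θ - (q : ℝ) = 0)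
    (huniq : ∀ x : ℝ, x ^ 3 - (p : ℝ) * x - (q : ℝ) = 0 → x = θ)
    (lam : ℝ) (hlam : 1 < lam)
    (hint : IsIntegral ℤ lam) (hintinv : IsIntegral ℤ lam⁻¹)
    (a b c : ℕ → ℚ)
    (hcoord : ∀ n : ℕ, 1 ≤ n →
      lam ^ n = (a n : ℝ) + (b n : ℝ) * θ + (c n : ℝ) * θ ^ 2)
    (C₁ : ℝ)
    (hC₁ : C₁ = max (Real.sqrt 2) (Real.sqrt 2 * |θ| / Real.sqrt (3 * θ ^ 2 - 4 * (p : ℝ))))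
    (n : ℕ) (hn : 1 ≤ n) :
    |(a n : ℝ) + (p : ℝ) * (c n : ℝ) - (b n : ℝ) * θ| < C₁ / lam ^ ((n : ℝ) / 2) ∧
    |(a n : ℝ) + (p : ℝ) * (c n : ℝ) - (c n : ℝ) * θ ^ 2| < C₁ / lam ^ ((n : ℝ) / 2) ∧
    (|(b n : ℝ) * θ - (c n : ℝ) * θ ^ 2|
        < (2 * |θ| / Real.sqrt (3 * θ ^ 2 - 4 * (p : ℝ))) * lam ^ (-(n : ℝ) / 2) ∧
      (2 * |θ| / Real.sqrt (3 * θ ^ 2 - 4 * (p : ℝ))) * lam ^ (-(n : ℝ) / 2)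
        ≤ Real.sqrt 2 * C₁ / lam ^ ((n : ℝ) / 2)) ∧
    |lam ^ n - (3 * θ ^ 2 - (p : ℝ)) * (c n : ℝ)|
        < (1 + Real.sqrt 2) * C₁ / lam ^ ((n : ℝ) / 2) := by
  have hroot' : θ ^ 3 - ((p : ℚ) : ℝ) * θ - ((q : ℚ) : ℝ) = 0 := by simpa using hroot
  have hdisc : 0 < 3 * θ ^ 2 - 4 * ((p : ℚ) : ℝ) :=
    cofactor_discr_neg hirr hroot' (by simpa using huniq)
  have hindep {x y z : ℚ} (h : (x : ℝ) + y * θ + z * θ ^ 2 = 0) :=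
    coords_eq_zero_of_irreducible_cubic hirr hroot' h
  have hlam0 : 0 < lam := by linarith
  have hL := hcoord n hn
  have hnorm := unit_mul_conjugate_normSq hirr hroot' hdisc
    (x := a n) (y := b n) (z := c n) (hL ▸ pow_pos hlam0 n) (hL ▸ hint.pow n)
    (hL ▸ inv_pow lam n ▸ hintinv.pow n)
  rw [← hL] at hnorm
  simp only [Rat.cast_intCast] at hdisc hnorm
  have hs2 : √(3 * θ ^ 2 - 4 * (p : ℝ)) ^ 2 = 3 * θ ^ 2 - 4 * p := Real.sq_sqrt hdisc.le
  have hs : 0 < √(3 * θ ^ 2 - 4 * (p : ℝ)) := Real.sqrt_pos.mpr hdisc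
  set s := √(3 * θ ^ 2 - 4 * (p : ℝ))
  have hneg : lam ^ (-(n : ℝ) / 2) = (lam ^ ((n : ℝ) / 2))⁻¹ := by
    rw [neg_div, Real.rpow_neg hlam0.le]
  have hR2 : (lam ^ ((n : ℝ) / 2)) ^ 2 = lam ^ n := by
    rw [← Real.rpow_natCast, ← Real.rpow_mul hlam0.le, ← Real.rpow_natCast]
    congr 1
    push_cast
    ring
  have hR : 0 < lam ^ ((n : ℝ) / 2) := Real.rpow_pos_of_pos hlam0 _
  rw [hneg]
  set R := lam ^ ((n : ℝ) / 2)
  set u : ℝ := (a n + p * c n - c n * θ ^ 2) - (b n - c n * θ) * θ / 2 with hu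
  set v : ℝ := (b n - c n * θ) * s / 2 with hv
  have huv : R ^ 2 * (u ^ 2 + v ^ 2) = 1 := by
    rw [hR2, ← hnorm, ← hs2, hv]
    ring
  have hθ : θ ≠ 0 := fun h => one_ne_zero
    (hindep (x := 0) (y := 1) (z := 0) (by push_cast; linarith)).2.1
  have ht : (θ / s) ^ 2 ≠ 1 := by
    rw [div_pow, Ne, div_eq_one_iff_eq (by positivity), hs2]
    intro h
    exact one_ne_zero (hindep (x := -2 * p) (y := 0) (z := 1) (by push_cast; linarith)).2.2
  have hM : C₁ = max √2 (√2 * |θ / s|) := by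
    rw [hC₁, abs_div, abs_of_pos hs, mul_div_assoc]
  have hu0 : u ≠ 0 := by
    intro h
    obtain ⟨h1, h2, h3⟩ := hindep (x := a n + p * c n) (y := - b n / 2) (z := - c n / 2)
      (by push_cast; rw [← h, hu]; ring)
    have hc : c n = 0 := by linarith
    have hb : b n = 0 := by linarith
    have ha : a n = 0 := by simpa [hc] using h1
    rw [ha, hb, hc] at hL
    simp at hL
    exact hlam0.ne' hL.1
  have hvt : v * (θ / s) = (b n - c n * θ) * θ / 2 := by
    rw [hv]; field_simp
  have h1 : |(a n : ℝ) + p * c n - b n * θ| < C₁ / R := by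
    have := abs_add_mul_lt (u := u) (v := -v) hR (by rwa [neg_sq]) ht hM
    rwa [neg_mul, hvt, show u + -((b n - c n * θ) * θ / 2) = a n + p * c n - b n * θ by
      rw [hu]; ring] at this
  have h2 : |(a n : ℝ) + p * c n - c n * θ ^ 2| < C₁ / R := by
    have := abs_add_mul_lt hR huv ht hM
    rwa [hvt, hu, sub_add_cancel] at this
  have hv1 : |v| < R⁻¹ := by
    refine lt_of_pow_lt_pow_left₀ 2 (by positivity) ?_
    rw [sq_abs, inv_pow, ← one_div, lt_div_iff₀ (by positivity)]
    have : 0 < R ^ 2 * u ^ 2 := by positivity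
    linarith
  have h3 : |(b n : ℝ) * θ - c n * θ ^ 2| < 2 * |θ| / s * R⁻¹ := by
    rw [show (b n : ℝ) * θ - c n * θ ^ 2 = 2 * θ / s * v by rw [hv]; field_simp,
      abs_mul, abs_div, abs_mul, abs_two, abs_of_pos hs]
    gcongr
  have h4 : 2 * |θ| / s * R⁻¹ ≤ √2 * C₁ / R := by
    rw [← div_eq_mul_inv]
    gcongr
    calc 2 * |θ| / s = √2 * (√2 * |θ| / s) := by
          rw [← mul_div_assoc, ← mul_assoc, Real.mul_self_sqrt zero_le_two]
      _ ≤ √2 * C₁ := by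
          rw [hC₁]
          gcongr
          exact le_max_right _ _
  refine ⟨h1, h2, ⟨h3, h4⟩, ?_⟩
  calc |lam ^ n - (3 * θ ^ 2 - (p : ℝ)) * c n|
      = |(a n + p * c n - c n * θ ^ 2) + (b n * θ - c n * θ ^ 2)| := by rw [hL]; ring_nf
    _ ≤ |(a n : ℝ) + p * c n - c n * θ ^ 2| + |(b n : ℝ) * θ - c n * θ ^ 2| := abs_add_le _ _
    _ < C₁ / R + √2 * C₁ / R := add_lt_add h2 (h3.trans_le h4)
    _ = (1 + √2) * C₁ / R := by ring
end

section
/- With the setup below, if n is a positive integer with λ^(3n/2) > 2·(1 + √2)·C₁, then cₙ > 0 and |λ^(n/2) − √(3θ² − p)·√cₙ| < √2·C₁/λⁿ. -/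
open Polynomial

/-- The polynomials vanishing at a root of an irreducible polynomial are its multiples. -/
theorem aeval_eq_zero_iff_dvd_of_irreducible {F E : Type*} [Field F] [Field E] [Algebra F E]
    {f : F[X]} (hf : Irreducible f) {x : E} (hx : aeval x f = 0) (g : F[X]) :
    aeval x g = 0 ↔ f ∣ g := by
  have hlead : IsUnit (C f.leadingCoeff⁻¹) := by simpa using hf.ne_zero
  rw [← minpoly.dvd_iff, ← minpoly.eq_of_irreducible hf hx, IsUnit.mul_right_dvd hlead]

/-- Roots, in two field extensions, of the same irreducible polynomial satisfy the same
polynomial equations. -/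
theorem aeval_eq_zero_iff_of_irreducible {F E E' : Type*} [Field F] [Field E] [Field E']
    [Algebra F E] [Algebra F E'] {f : F[X]} (hf : Irreducible f) {x : E} {y : E'}
    (hx : aeval x f = 0) (hy : aeval y f = 0) (g : F[X]) :
    aeval x g = 0 ↔ aeval y g = 0 := by
  rw [aeval_eq_zero_iff_dvd_of_irreducible hf hx, aeval_eq_zero_iff_dvd_of_irreducible hf hy]

/-- A positive rational number which is an algebraic integer together with its inverse is `1`. -/
theorem Rat.eq_one_of_isIntegral_inv {r : ℚ} (hr : 0 < r) (h : IsIntegral ℤ r)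
    (h' : IsIntegral ℤ r⁻¹) : r = 1 := by
  obtain ⟨k, rfl⟩ := IsIntegrallyClosed.isIntegral_iff.mp h
  obtain ⟨l, hl⟩ := IsIntegrallyClosed.isIntegral_iff.mp h'
  simp only [eq_intCast] at *
  have hk : (0 : ℤ) < k := by exact_mod_cast hr
  have hkl : k * l = 1 := by
    have : (k : ℚ) * l = 1 := by rw [hl]; exact mul_inv_cancel₀ hr.ne'
    exact_mod_cast this
  have := Int.eq_one_or_neg_one_of_mul_eq_one hkl
  have : k = 1 := by omega
  simp [this]

/-- A cubic `x³ - px - q` irreducible over `ℚ` with a unique real root `θ` has `3θ² - 4p > 0`. -/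
theorem cubic_disc_pos_of_unique_root {p q : ℤ} {θ : ℝ}
    (hirr : Irreducible (X ^ 3 - C (p : ℚ) * X - C (q : ℚ)))
    (hroot : θ ^ 3 - (p : ℝ) * θ - (q : ℝ) = 0)
    (huniq : ∀ x : ℝ, x ^ 3 - (p : ℝ) * x - (q : ℝ) = 0 → x = θ) :
    0 < 3 * θ ^ 2 - 4 * (p : ℝ) := by
  by_contra! hneg
  set w := Real.sqrt (4 * (p : ℝ) - 3 * θ ^ 2) with hw
  have hw2 : w ^ 2 = 4 * (p : ℝ) - 3 * θ ^ 2 := Real.sq_sqrt (by linarith)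
  have h₁ := huniq ((-θ + w) / 2) (by
    linear_combination hroot + (-3 * θ + w) / 8 * hw2)
  have h₂ := huniq ((-θ - w) / 2) (by
    linear_combination hroot + (-3 * θ - w) / 8 * hw2)
  have hθ : θ = 0 := by linarith
  have hw0 : w = 0 := by linarith
  have hp : p = 0 := by
    have : (p : ℝ) = 0 := by rw [hw0, hθ] at hw2; linarith
    exact_mod_cast this
  have hq : q = 0 := by
    have : (q : ℝ) = 0 := by rw [hθ] at hroot; linarith
    exact_mod_cast this
  subst hp hq
  refine not_irreducible_pow (M := ℚ[X]) (n := 3) (by norm_num) (x := X) ?_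
  simpa using hirr

/-- If `x = a + bθ + cθ²` is a positive real unit in the ring of algebraic integers, where `θ` is
a real root of the irreducible cubic `X³ - pX - q`, and `ν = a + bμ + cμ²` is its conjugate
attached to the non-real root `μ = -θ/2 + is`, then `x |ν|² = 1`. -/
theorem unit_mul_conj_sq_eq_one {p q : ℤ} {θ s x : ℝ}
    (hirr : Irreducible (X ^ 3 - C (p : ℚ) * X - C (q : ℚ)))
    (hroot : θ ^ 3 - (p : ℝ) * θ - (q : ℝ) = 0)
    (hs : 4 * s ^ 2 = 3 * θ ^ 2 - 4 * (p : ℝ))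
    (hx : 0 < x) (hint : IsIntegral ℤ x) (hintinv : IsIntegral ℤ x⁻¹) {a b c : ℚ}
    (hcoord : x = (a : ℝ) + (b : ℝ) * θ + (c : ℝ) * θ ^ 2) :
    x * ((a - b * θ / 2 + c * (θ ^ 2 / 4 - s ^ 2)) ^ 2 + (s * (b - c * θ)) ^ 2) = 1 := by
  set u : ℝ := a - b * θ / 2 + c * (θ ^ 2 / 4 - s ^ 2) with hu
  set v : ℝ := s * (b - c * θ) with hv
  set μ : ℂ := ⟨-θ / 2, s⟩ with hμ
  set ν : ℂ := ⟨u, v⟩ with hν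
  set f : ℚ[X] := X ^ 3 - C (p : ℚ) * X - C (q : ℚ) with hf
  set g : ℚ[X] := C a + C b * X + C c * X ^ 2 with hg
  have hfθ : aeval θ f = 0 := by simpa [hf] using hroot
  have hfμ : aeval μ f = 0 := by
    apply Complex.ext
    · simp [hf, hμ, pow_succ]
      linear_combination hroot + 3 / 8 * θ * hs
    · simp [hf, hμ, pow_succ]
      linear_combination -s / 4 * hs
  have hgθ : aeval θ g = x := by simp [hg, hcoord]
  have hgμ : aeval μ g = ν := by
    apply Complex.ext
    · simp [hg, hμ, hν, hu, pow_succ]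
      ring
    · simp [hg, hμ, hν, hv, pow_succ]
      ring
  have transfer : ∀ P : ℤ[X], aeval x P = 0 → aeval ν P = 0 := by
    intro P hP
    have h := (aeval_eq_zero_iff_of_irreducible hirr hfθ hfμ
      ((P.map (algebraMap ℤ ℚ)).comp g)).mp (by
        rw [aeval_comp, hgθ, aeval_map_algebraMap, hP])
    rwa [aeval_comp, hgμ, aeval_map_algebraMap] at h
  have hν0 : ν ≠ 0 := by
    intro h0
    have h := (aeval_eq_zero_iff_of_irreducible hirr hfθ hfμ g).mpr (by rw [hgμ, h0])
    rw [hgθ] at h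
    exact hx.ne' h
  have hνint : IsIntegral ℤ ν := by
    obtain ⟨P, hP, hPx⟩ := hint
    exact ⟨P, hP, transfer P hPx⟩
  have hνinv : IsIntegral ℤ ν⁻¹ := by
    obtain ⟨P, hP, hPx⟩ := hintinv
    refine ⟨P, hP, ?_⟩
    have h := transfer P.reverse (by
      rw [aeval_def]
      let : Invertible x⁻¹ := invertibleOfNonzero (inv_ne_zero hx.ne')
      have h := (eval₂_reverse_eq_zero_iff (algebraMap ℤ ℝ) x⁻¹ P).mpr hPx
      simpa using h)
    let : Invertible ν⁻¹ := invertibleOfNonzero (inv_ne_zero hν0)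
    refine (eval₂_reverse_eq_zero_iff (algebraMap ℤ ℂ) ν⁻¹ P).mp ?_
    simpa [aeval_def] using h
  have hconj : ∀ z : ℂ, IsIntegral ℤ z → IsIntegral ℤ (starRingEnd ℂ z) := fun z hz =>
    hz.map (starRingEnd ℂ).toIntAlgHom
  set N : ℚ := a ^ 3 + b ^ 3 * q + c ^ 3 * q ^ 2 - 3 * a * b * c * q + 2 * p * a ^ 2 * c
    - p * a * b ^ 2 + p ^ 2 * a * c ^ 2 - p * q * b * c ^ 2 with hN
  have hNx : (N : ℝ) = x * (u ^ 2 + v ^ 2) := by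
    have hs' : s ^ 2 = 3 / 4 * θ ^ 2 - p := by linarith
    have hq' : (q : ℝ) = θ ^ 3 - p * θ := by linarith
    rw [hv, mul_pow, hu, hs', hcoord, hN]
    push_cast
    rw [hq']
    ring
  have hNν : (N : ℂ) = x * (ν * starRingEnd ℂ ν) := by
    rw [Complex.mul_conj, Complex.normSq_mk, ← sq, ← sq]
    exact_mod_cast congrArg (fun r : ℝ => (r : ℂ)) hNx
  have hxC : IsIntegral ℤ (x : ℂ) := hint.map Complex.ofRealHom.toIntAlgHom
  have hxinvC : IsIntegral ℤ ((x : ℂ)⁻¹) := by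
    simpa using hintinv.map Complex.ofRealHom.toIntAlgHom
  have hinj : Function.Injective (algebraMap ℚ ℂ) := (algebraMap ℚ ℂ).injective
  have hNint : IsIntegral ℤ N := by
    rw [← isIntegral_algebraMap_iff hinj, eq_ratCast, hNν]
    exact hxC.mul (hνint.mul (hconj _ hνint))
  have hNinv : IsIntegral ℤ N⁻¹ := by
    rw [← isIntegral_algebraMap_iff hinj, eq_ratCast, Rat.cast_inv, hNν, mul_inv, mul_inv,
      ← map_inv₀]
    exact hxinvC.mul (hνinv.mul (hconj _ hνinv))
  have hNpos : 0 < N := by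
    have h : 0 < Complex.normSq ν := Complex.normSq_pos.mpr hν0
    rw [Complex.normSq_mk, ← sq, ← sq] at h
    have : (0 : ℝ) < N := by rw [hNx]; positivity
    exact_mod_cast this
  rw [← hNx, Rat.eq_one_of_isIntegral_inv hNpos hNint hNinv, Rat.cast_one]

/-- A quantitative estimate for `√(r² + E)` as an approximation of `r`. -/
theorem sqrt_sq_add_approx {r m E : ℝ} (hr : 0 < r) (hm : 0 < m)
    (hE : (E * r) ^ 2 ≤ 10 * m ^ 2) (hbig : 6.8 * m < r ^ 3) :
    0 < r ^ 2 + E ∧ |r - Real.sqrt (r ^ 2 + E)| < 2 * m / r ^ 2 := by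
  obtain ⟨hl, hu⟩ := abs_le_of_sq_le_sq' (show (E * r) ^ 2 ≤ (3.2 * m) ^ 2 by nlinarith)
    (by positivity)
  have hlow : (0.7 * r) ^ 2 < r ^ 2 + E := by
    have : 0 < r * (r ^ 2 + E - (0.7 * r) ^ 2) := by nlinarith
    have := pos_of_mul_pos_right this hr.le
    linarith
  have hpos : 0 < r ^ 2 + E := lt_of_le_of_lt (sq_nonneg _) hlow
  refine ⟨hpos, ?_⟩
  set y := Real.sqrt (r ^ 2 + E) with hy
  have hy2 : y ^ 2 = r ^ 2 + E := Real.sq_sqrt hpos.le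
  have hyr : 0.7 * r < y := Real.lt_sqrt_of_sq_lt hlow
  have hprod : |r - y| * ((r + y) * r) = |E * r| := by
    have hs : 0 < (r + y) * r := by positivity
    rw [← abs_of_pos hs, ← abs_mul, ← abs_neg (E * r)]
    congr 1
    linear_combination -r * hy2
  have hEr : |E * r| ≤ 3.2 * m := abs_le.mpr ⟨by linarith, hu⟩
  have hge : |r - y| * (1.7 * r ^ 2) ≤ |r - y| * ((r + y) * r) := by
    refine mul_le_mul_of_nonneg_left ?_ (abs_nonneg _)
    nlinarith
  rw [lt_div_iff₀ (by positivity)]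
  nlinarith

/-- **Lemma.** With the usual setup, if `λ^(3n/2) > 2(1+√2)C₁` then `cₙ > 0` and
`|λ^(n/2) - √(3θ² - p)·√cₙ| < √2 C₁/λⁿ`. -/
theorem sqrt_lambda_approximation
    (p q : ℤ) (θ : ℝ)
    (hirr : Irreducible (X ^ 3 - C (p : ℚ) * X - C (q : ℚ)))
    (hroot : θ ^ 3 - (p : ℝ) * θ - (q : ℝ) = 0)
    (huniq : ∀ x : ℝ, x ^ 3 - (p : ℝ) * x - (q : ℝ) = 0 → x = θ)
    (lam : ℝ) (hlam : 1 < lam)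
    (hint : IsIntegral ℤ lam) (hintinv : IsIntegral ℤ lam⁻¹)
    (a b c : ℕ → ℚ)
    (hcoord : ∀ n : ℕ, 1 ≤ n →
      lam ^ n = (a n : ℝ) + (b n : ℝ) * θ + (c n : ℝ) * θ ^ 2)
    (C₁ : ℝ)
    (hC₁ : C₁ = max (Real.sqrt 2) (Real.sqrt 2 * |θ| / Real.sqrt (3 * θ ^ 2 - 4 * (p : ℝ))))
    (n : ℕ) (hn : 1 ≤ n)
    (hbig : lam ^ (3 * (n : ℝ) / 2) > 2 * (1 + Real.sqrt 2) * C₁) :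
    0 < c n ∧
    |lam ^ ((n : ℝ) / 2) - Real.sqrt (3 * θ ^ 2 - (p : ℝ)) * Real.sqrt ((c n : ℝ))|
      < Real.sqrt 2 * C₁ / lam ^ n := by
  have hD := cubic_disc_pos_of_unique_root hirr hroot huniq
  set D := Real.sqrt (3 * θ ^ 2 - 4 * (p : ℝ)) with hDdef
  have hD2 : D ^ 2 = 3 * θ ^ 2 - 4 * (p : ℝ) := Real.sq_sqrt hD.le
  have hDpos : 0 < D := Real.sqrt_pos.mpr hD
  have hlam0 : 0 < lam := by linarith
  set r := lam ^ ((n : ℝ) / 2) with hrdef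
  have hr : 0 < r := Real.rpow_pos_of_pos hlam0 _
  have hr2 : lam ^ n = r ^ 2 := by
    rw [hrdef, ← Real.rpow_natCast, ← Real.rpow_natCast, ← Real.rpow_mul hlam0.le]
    congr 1
    push_cast
    ring
  have hr3 : lam ^ (3 * (n : ℝ) / 2) = r ^ 3 := by
    rw [hrdef, ← Real.rpow_natCast, ← Real.rpow_mul hlam0.le]
    congr 1
    push_cast
    ring
  have hcn := hcoord n hn
  have hnorm := unit_mul_conj_sq_eq_one (s := D / 2) hirr hroot (by rw [← hD2]; ring)
    (pow_pos hlam0 n) (hint.pow n) (by rw [← inv_pow]; exact hintinv.pow n) hcn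
  set u : ℝ := a n - b n * θ / 2 + c n * (θ ^ 2 / 4 - (D / 2) ^ 2) with hu
  set v : ℝ := D / 2 * (b n - c n * θ) with hv
  set t := |θ| / D with ht
  set E := -u - 3 * (θ / D) * v with hE
  have hkey : (3 * θ ^ 2 - (p : ℝ)) * c n = r ^ 2 + E := by
    have hDv : θ / D * v = θ * (b n - c n * θ) / 2 := by
      rw [hv]
      field_simp
    rw [hE, ← hr2, hcn, mul_assoc, hDv, hu]
    linear_combination (-(c n : ℝ) / 4) * hD2
  set m := max 1 t with hm
  have hm1 : 1 ≤ m := le_max_left _ _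
  have hmt : t ≤ m := le_max_right _ _
  have ht0 : 0 ≤ t := by positivity
  have ht2 : (θ / D) ^ 2 = t ^ 2 := by rw [ht, div_pow, div_pow, sq_abs]
  have hCm : C₁ = Real.sqrt 2 * m := by
    rw [hC₁, hm, mul_max_of_nonneg _ _ (Real.sqrt_nonneg 2), mul_one, ht, mul_div_assoc]
  have hs2 : Real.sqrt 2 ^ 2 = 2 := Real.sq_sqrt (by norm_num)
  have hs14 : 1.4 < Real.sqrt 2 := Real.lt_sqrt_of_sq_lt (by norm_num)
  have hE2 : (E * r) ^ 2 ≤ 10 * m ^ 2 := by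
    have hcs : E ^ 2 ≤ (1 + 9 * t ^ 2) * (u ^ 2 + v ^ 2) := by
      rw [← ht2, hE]
      linarith [sq_nonneg (v - 3 * (θ / D) * u)]
    have : (E * r) ^ 2 ≤ 1 + 9 * t ^ 2 :=
      calc (E * r) ^ 2 = r ^ 2 * E ^ 2 := by ring
        _ ≤ r ^ 2 * ((1 + 9 * t ^ 2) * (u ^ 2 + v ^ 2)) := by gcongr
        _ = (1 + 9 * t ^ 2) * (lam ^ n * (u ^ 2 + v ^ 2)) := by rw [hr2]; ring
        _ = 1 + 9 * t ^ 2 := by rw [hnorm, mul_one]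
    have : t ^ 2 ≤ m ^ 2 := by gcongr
    have : 1 ≤ m ^ 2 := one_le_pow₀ hm1
    linarith
  have hbig' : 6.8 * m < r ^ 3 := by
    rw [hr3, hCm] at hbig
    have : 2 * (1 + Real.sqrt 2) * (Real.sqrt 2 * m) = (2 * Real.sqrt 2 + 4) * m := by
      linear_combination 2 * m * hs2
    rw [this] at hbig
    refine lt_trans (mul_lt_mul_of_pos_right ?_ (by linarith)) hbig
    linarith
  obtain ⟨hpos, happrox⟩ := sqrt_sq_add_approx hr (by linarith) hE2 hbig'
  have hderiv : 0 < 3 * θ ^ 2 - (p : ℝ) := by linarith [sq_nonneg θ]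
  constructor
  · rw [← hkey] at hpos
    exact_mod_cast pos_of_mul_pos_right hpos hderiv.le
  · rw [← Real.sqrt_mul hderiv.le, hkey, hr2, hCm, ← mul_assoc, ← sq, hs2]
    exact happrox
end
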